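/- arXiv:2108.05396 — 17 statements merged into one kernel-verified Lean document; each statement's English description precedes it below -/
import Mathlib

section
/- Suppose x^s ∈ ℝ^N has all components strictly positive and is complex balanced. Then: (a) x^s is a steady state of the reaction rate equation, i.e. R(x^s) = 0; (b) for every q ∈ ℝ^N with ν_j·q = 0 for all j = 1,…,M, the state x* defined componentwise by x*_i := x^s_i e^{q_i} is also complex balanced, and hence is also a positive steady state of the reaction rate equation. -/
open scoped BigOperators

/-- Dot product on `Fin N → ℝ`. -/
noncomputable def dotv {N : ℕ} (a b : Fin N → ℝ) : ℝ := ∑ i, a i * b i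

/-- Reaction vector `ν_j = ν⁻_j − ν⁺_j`. -/
noncomputable def nuv {N M : ℕ} (νp νm : Fin M → Fin N → ℕ) (j : Fin M) : Fin N → ℝ :=
  fun i => (νm j i : ℝ) - (νp j i : ℝ)

/-- Forward law of mass action flux `Φ⁺_j(x) = k⁺_j ∏ x_i^{ν⁺_{ji}}`. -/
noncomputable def PhiP {N M : ℕ} (νp : Fin M → Fin N → ℕ) (kp : Fin M → ℝ)
    (x : Fin N → ℝ) (j : Fin M) : ℝ := kp j * ∏ i, x i ^ (νp j i)

/-- Backward law of mass action flux `Φ⁻_j(x) = k⁻_j ∏ x_i^{ν⁻_{ji}}`. -/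
noncomputable def PhiM {N M : ℕ} (νm : Fin M → Fin N → ℕ) (km : Fin M → ℝ)
    (x : Fin N → ℝ) (j : Fin M) : ℝ := km j * ∏ i, x i ^ (νm j i)

/-- Right hand side of the reaction rate equation `R(x) = Σ_j ν_j (Φ⁺_j(x) − Φ⁻_j(x))`. -/
noncomputable def RRE {N M : ℕ} (νp νm : Fin M → Fin N → ℕ) (kp km : Fin M → ℝ)
    (x : Fin N → ℝ) : Fin N → ℝ :=
  fun i => ∑ j, nuv νp νm j i * (PhiP νp kp x j - PhiM νm km x j)

/-- A positive state `xs` is complex balanced if for every complex `η` (an element of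
`C = {ν⁺_j} ∪ {ν⁻_j}`), the total net flux through `η` vanishes. -/
def ComplexBalanced {N M : ℕ} (νp νm : Fin M → Fin N → ℕ) (kp km : Fin M → ℝ)
    (xs : Fin N → ℝ) : Prop :=
  ∀ η : Fin N → ℕ, ((∃ j, νp j = η) ∨ (∃ j, νm j = η)) →
    (∑ j ∈ Finset.univ.filter (fun j => νp j = η),
        (PhiM νm km xs j - PhiP νp kp xs j))
    + (∑ j ∈ Finset.univ.filter (fun j => νm j = η),
        (PhiP νp kp xs j - PhiM νm km xs j)) = 0

theorem RRE_zero_of_cb {N M : ℕ} (νp νm : Fin M → Fin N → ℕ) (kp km : Fin M → ℝ)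
    (x : Fin N → ℝ) (hcb : ComplexBalanced νp νm kp km x) (i : Fin N) :
    RRE νp νm kp km x i = 0 := by
  classical
  set F : Fin M → ℝ := fun j => PhiP νp kp x j - PhiM νm km x j with hF
  set C : Finset (Fin N → ℕ) := Finset.univ.image νp ∪ Finset.univ.image νm with hC
  have hp : ∀ j ∈ (Finset.univ : Finset (Fin M)), νp j ∈ C := by
    intro j _; simp [hC]
  have hm : ∀ j ∈ (Finset.univ : Finset (Fin M)), νm j ∈ C := by
    intro j _; simp [hC]
  have h1 : ∑ j, (νp j i : ℝ) * F j
      = ∑ η ∈ C, (η i : ℝ) * ∑ j ∈ Finset.univ.filter (fun j => νp j = η), F j := by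
    rw [← Finset.sum_fiberwise_of_maps_to hp]
    refine Finset.sum_congr rfl fun η _ => ?_
    rw [Finset.mul_sum]
    refine Finset.sum_congr rfl fun j hj => ?_
    rw [(Finset.mem_filter.1 hj).2]
  have h2 : ∑ j, (νm j i : ℝ) * F j
      = ∑ η ∈ C, (η i : ℝ) * ∑ j ∈ Finset.univ.filter (fun j => νm j = η), F j := by
    rw [← Finset.sum_fiberwise_of_maps_to hm]
    refine Finset.sum_congr rfl fun η _ => ?_
    rw [Finset.mul_sum]
    refine Finset.sum_congr rfl fun j hj => ?_
    rw [(Finset.mem_filter.1 hj).2]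
  have h3 : RRE νp νm kp km x i = ∑ j, (νm j i : ℝ) * F j - ∑ j, (νp j i : ℝ) * F j := by
    rw [← Finset.sum_sub_distrib]
    unfold RRE nuv
    refine Finset.sum_congr rfl fun j _ => ?_
    simp only [hF]; ring
  rw [h3, h1, h2, ← Finset.sum_sub_distrib]
  refine Finset.sum_eq_zero fun η hη => ?_
  have hη' : (∃ j, νp j = η) ∨ (∃ j, νm j = η) := by
    simpa [hC] using hη
  have h := hcb η hη'
  have h4 : ∑ j ∈ Finset.univ.filter (fun j => νp j = η), (PhiM νm km x j - PhiP νp kp x j)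
      = - ∑ j ∈ Finset.univ.filter (fun j => νp j = η), F j := by
    rw [← Finset.sum_neg_distrib]
    refine Finset.sum_congr rfl fun j _ => ?_
    simp only [hF]; ring
  rw [h4] at h
  have h5 : ∑ j ∈ Finset.univ.filter (fun j => νm j = η), F j
      = ∑ j ∈ Finset.univ.filter (fun j => νp j = η), F j := by
    simp only [hF] at h ⊢
    linarith
  rw [h5, sub_self]

theorem prod_exp_shift {N : ℕ} (x q : Fin N → ℝ) (η : Fin N → ℕ) :
    ∏ i, (x i * Real.exp (q i)) ^ (η i)
      = Real.exp (∑ i, (η i : ℝ) * q i) * ∏ i, x i ^ (η i) := by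
  rw [Real.exp_sum, ← Finset.prod_mul_distrib]
  refine Finset.prod_congr rfl fun i _ => ?_
  rw [mul_pow, Real.exp_nat_mul, mul_comm]

theorem cb_shift {N M : ℕ} (νp νm : Fin M → Fin N → ℕ) (kp km : Fin M → ℝ)
    (x : Fin N → ℝ) (hcb : ComplexBalanced νp νm kp km x) (q : Fin N → ℝ)
    (hq : ∀ j, dotv (nuv νp νm j) q = 0) :
    ComplexBalanced νp νm kp km (fun i => x i * Real.exp (q i)) := by
  have he : ∀ j, ∑ i, (νm j i : ℝ) * q i = ∑ i, (νp j i : ℝ) * q i := by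
    intro j
    have h := hq j
    simp only [dotv, nuv, sub_mul, Finset.sum_sub_distrib] at h
    linarith
  have hP : ∀ j, PhiP νp kp (fun i => x i * Real.exp (q i)) j
      = Real.exp (∑ i, (νp j i : ℝ) * q i) * PhiP νp kp x j := by
    intro j
    simp only [PhiP, prod_exp_shift]; ring
  have hM : ∀ j, PhiM νm km (fun i => x i * Real.exp (q i)) j
      = Real.exp (∑ i, (νm j i : ℝ) * q i) * PhiM νm km x j := by
    intro j
    simp only [PhiM, prod_exp_shift]; ring
  intro η hη
  have h := hcb η hη
  have hA : ∑ j ∈ Finset.univ.filter (fun j => νp j = η),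
        (PhiM νm km (fun i => x i * Real.exp (q i)) j
          - PhiP νp kp (fun i => x i * Real.exp (q i)) j)
      = Real.exp (∑ i, (η i : ℝ) * q i) * ∑ j ∈ Finset.univ.filter (fun j => νp j = η),
        (PhiM νm km x j - PhiP νp kp x j) := by
    rw [Finset.mul_sum]
    refine Finset.sum_congr rfl fun j hj => ?_
    rw [hP, hM, he, (Finset.mem_filter.1 hj).2, mul_sub]
  have hB : ∑ j ∈ Finset.univ.filter (fun j => νm j = η),
        (PhiP νp kp (fun i => x i * Real.exp (q i)) j
          - PhiM νm km (fun i => x i * Real.exp (q i)) j)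
      = Real.exp (∑ i, (η i : ℝ) * q i) * ∑ j ∈ Finset.univ.filter (fun j => νm j = η),
        (PhiP νp kp x j - PhiM νm km x j) := by
    rw [Finset.mul_sum]
    refine Finset.sum_congr rfl fun j hj => ?_
    rw [hP, hM, ← he, (Finset.mem_filter.1 hj).2, mul_sub]
  rw [hA, hB, ← mul_add, h, mul_zero]

/-- a positive complex balanced state is a steady state of the RRE, and
for every `q` with `ν_j ⬝ q = 0` for all `j`, the state `x*_i = xs_i e^{q_i}` is again
positive, complex balanced, and a steady state of the RRE. -/
theorem stmt1 {N M : ℕ} (νp νm : Fin M → Fin N → ℕ) (kp km : Fin M → ℝ)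
    (hkp : ∀ j, 0 ≤ kp j) (hkm : ∀ j, 0 ≤ km j)
    (xs : Fin N → ℝ) (hxs : ∀ i, 0 < xs i)
    (hcb : ComplexBalanced νp νm kp km xs) :
    (∀ i, RRE νp νm kp km xs i = 0) ∧
    (∀ q : Fin N → ℝ, (∀ j, dotv (nuv νp νm j) q = 0) →
      (∀ i, 0 < xs i * Real.exp (q i)) ∧
      ComplexBalanced νp νm kp km (fun i => xs i * Real.exp (q i)) ∧
      (∀ i, RRE νp νm kp km (fun i => xs i * Real.exp (q i)) i = 0)) := by
  exact ⟨RRE_zero_of_cb νp νm kp km xs hcb, fun q hq =>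
    ⟨fun i => mul_pos (hxs i) (Real.exp_pos _), cb_shift νp νm kp km xs hcb q hq,
      RRE_zero_of_cb νp νm kp km _ (cb_shift νp νm kp km xs hcb q hq)⟩⟩
end

section
/- Assume k⁺_j > 0 and k⁻_j > 0 for every j, and let x^s ∈ ℝ^N have all components strictly positive and satisfy detailed balance. If x^e ∈ ℝ^N has all components strictly positive and is a steady state of the reaction rate equation (R(x^e) = 0), then: (a) Φ⁺_j(x^e) = Φ⁻_j(x^e) for every j, i.e. x^e also satisfies detailed balance; (b) the vector with components log(x^e_i/x^s_i) satisfies ν_j·log(x^e/x^s) = 0 for every j; (c) if moreover x^e − x^s ∈ G, then x^e = x^s. In particular, within each stoichiometric compatibility class there is at most one positive steady state. -/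
open scoped BigOperators

theorem aux_nonneg (a b : ℝ) (ha : 0 < a) (hb : 0 < b) :
    0 ≤ (a - b) * (Real.log a - Real.log b) := by
  rcases le_total a b with h | h
  · have := Real.log_le_log ha h
    nlinarith
  · have := Real.log_le_log hb h
    nlinarith

theorem aux_eq (a b : ℝ) (ha : 0 < a) (hb : 0 < b)
    (h : (a - b) * (Real.log a - Real.log b) = 0) : a = b := by
  rcases mul_eq_zero.1 h with h | h
  · linarith
  · exact Real.log_injOn_pos ha hb (by linarith)

theorem aux_log {N : ℕ} (k : ℝ) (hk : 0 < k) (n : Fin N → ℕ) (x : Fin N → ℝ)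
    (hx : ∀ i, 0 < x i) :
    Real.log (k * ∏ i, x i ^ n i) = Real.log k + ∑ i, (n i : ℝ) * Real.log (x i) := by
  have h1 : ∀ i, x i ^ n i ≠ 0 := fun i => (pow_pos (hx i) _).ne'
  rw [Real.log_mul hk.ne' (Finset.prod_ne_zero_iff.2 fun i _ => h1 i),
    Real.log_prod (fun i _ => h1 i)]
  simp [Real.log_pow]

/-- under reversibility (`k⁺_j, k⁻_j > 0`) and existence of a positive
detailed balanced state `xs`, every positive steady state `xe` of the RRE is itself
detailed balanced, `log(xe/xs)` is orthogonal to all reaction vectors, and if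
`xe − xs` lies in the stoichiometric subspace `G = span{ν_j}` then `xe = xs`. -/
theorem stmt2 {N M : ℕ} (νp νm : Fin M → Fin N → ℕ) (kp km : Fin M → ℝ)
    (hkp : ∀ j, 0 < kp j) (hkm : ∀ j, 0 < km j)
    (xs : Fin N → ℝ) (hxs : ∀ i, 0 < xs i)
    (hdb : ∀ j, PhiP νp kp xs j = PhiM νm km xs j)
    (xe : Fin N → ℝ) (hxe : ∀ i, 0 < xe i)
    (hsteady : ∀ i, RRE νp νm kp km xe i = 0) :
    (∀ j, PhiP νp kp xe j = PhiM νm km xe j) ∧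
    (∀ j, dotv (nuv νp νm j) (fun i => Real.log (xe i / xs i)) = 0) ∧
    ((fun i => xe i - xs i) ∈ Submodule.span ℝ (Set.range (nuv νp νm)) → xe = xs) := by
  have hPpos : ∀ j, 0 < PhiP νp kp xe j := fun j =>
    mul_pos (hkp j) (Finset.prod_pos fun i _ => pow_pos (hxe i) _)
  have hMpos : ∀ j, 0 < PhiM νm km xe j := fun j =>
    mul_pos (hkm j) (Finset.prod_pos fun i _ => pow_pos (hxe i) _)
  have key : ∀ j, dotv (nuv νp νm j) (fun i => Real.log (xe i / xs i)) =
      Real.log (PhiM νm km xe j) - Real.log (PhiP νp kp xe j) := by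
    intro j
    have h := congrArg Real.log (hdb j)
    unfold PhiP PhiM at *
    rw [aux_log _ (hkp j) _ _ hxs, aux_log _ (hkm j) _ _ hxs] at h
    rw [aux_log _ (hkp j) _ _ hxe, aux_log _ (hkm j) _ _ hxe]
    have e : dotv (nuv νp νm j) (fun i => Real.log (xe i / xs i)) =
        ∑ i, (νm j i : ℝ) * Real.log (xe i) - ∑ i, (νp j i : ℝ) * Real.log (xe i)
        - (∑ i, (νm j i : ℝ) * Real.log (xs i) - ∑ i, (νp j i : ℝ) * Real.log (xs i)) := by
      unfold dotv nuv
      simp only [← Finset.sum_sub_distrib]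
      refine Finset.sum_congr rfl fun i _ => ?_
      rw [Real.log_div (hxe i).ne' (hxs i).ne']
      ring
    rw [e]
    linarith
  have hsum : ∑ j, (PhiP νp kp xe j - PhiM νm km xe j) *
      (Real.log (PhiP νp kp xe j) - Real.log (PhiM νm km xe j)) = 0 := by
    have h0 : ∑ i, RRE νp νm kp km xe i * Real.log (xe i / xs i) = 0 :=
      Finset.sum_eq_zero fun i _ => by rw [hsteady i, zero_mul]
    unfold RRE at h0
    simp only [Finset.sum_mul] at h0
    rw [Finset.sum_comm] at h0
    rw [← neg_eq_zero, ← Finset.sum_neg_distrib, ← h0]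
    refine Finset.sum_congr rfl fun j _ => ?_
    have hk := key j
    unfold dotv at hk
    calc _ = (PhiP νp kp xe j - PhiM νm km xe j) *
          (Real.log (PhiM νm km xe j) - Real.log (PhiP νp kp xe j)) := by ring
      _ = _ := by
        rw [← hk, Finset.mul_sum]
        exact Finset.sum_congr rfl fun i _ => by ring
  have ha : ∀ j, PhiP νp kp xe j = PhiM νm km xe j := fun j =>
    aux_eq _ _ (hPpos j) (hMpos j)
      ((Finset.sum_eq_zero_iff_of_nonneg
        (fun j _ => aux_nonneg _ _ (hPpos j) (hMpos j))).1 hsum j (Finset.mem_univ j))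
  have hb : ∀ j, dotv (nuv νp νm j) (fun i => Real.log (xe i / xs i)) = 0 := by
    intro j
    rw [key, ha, sub_self]
  refine ⟨ha, hb, fun hG => ?_⟩
  have hz : ∀ v ∈ Submodule.span ℝ (Set.range (nuv νp νm)),
      dotv v (fun i => Real.log (xe i / xs i)) = 0 := by
    intro v hv
    induction hv using Submodule.span_induction with
    | mem x h =>
      obtain ⟨j, rfl⟩ := h
      exact hb j
    | zero => simp [dotv]
    | add x y _ _ h1 h2 =>
      unfold dotv at *
      simp only [Pi.add_apply, add_mul, Finset.sum_add_distrib]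
      rw [h1, h2, add_zero]
    | smul c x _ h =>
      unfold dotv at *
      simp only [Pi.smul_apply, smul_eq_mul, mul_assoc, ← Finset.mul_sum]
      rw [h, mul_zero]
  have hs := hz _ hG
  have hs' : ∑ i, (xe i - xs i) * (Real.log (xe i) - Real.log (xs i)) = 0 := by
    rw [← hs]
    unfold dotv
    refine Finset.sum_congr rfl fun i _ => ?_
    beta_reduce
    rw [Real.log_div (hxe i).ne' (hxs i).ne']
  funext i
  exact aux_eq _ _ (hxe i) (hxs i)
      ((Finset.sum_eq_zero_iff_of_nonneg
        (fun j _ => aux_nonneg _ _ (hxe j) (hxs j))).1 hs' i (Finset.mem_univ i))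
end

section
/- Fix x ∈ ℝ^N with all components strictly positive and assume k⁺_j > 0 and k⁻_j > 0 for every j. Then the map p ↦ H(p,x) is convex on ℝ^N, and it is strictly convex in the stoichiometric directions: for every p ∈ ℝ^N and every nonzero α ∈ G, the real function t ↦ H(p + tα, x) is strictly convex on ℝ. -/
open scoped BigOperators

/-- The Hamiltonian `H(p,x) = Σ_j [Φ⁺_j(x)(e^{ν_j·p} − 1) + Φ⁻_j(x)(e^{−ν_j·p} − 1)]`. -/
noncomputable def Ham {N M : ℕ} (νp νm : Fin M → Fin N → ℕ) (kp km : Fin M → ℝ)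
    (p x : Fin N → ℝ) : ℝ :=
  ∑ j, (PhiP νp kp x j * (Real.exp (dotv (nuv νp νm j) p) - 1)
      + PhiM νm km x j * (Real.exp (-(dotv (nuv νp νm j) p)) - 1))

lemma dotv_comb {N : ℕ} (v p q : Fin N → ℝ) (a b : ℝ) :
    dotv v (a • p + b • q) = a * dotv v p + b * dotv v q := by
  simp only [dotv, Pi.add_apply, Pi.smul_apply, smul_eq_mul, Finset.mul_sum,
    ← Finset.sum_add_distrib]
  exact Finset.sum_congr rfl fun i _ => by ring

lemma term_strict {A B : ℝ} (hA : 0 < A) (hB : 0 < B) {s t a b : ℝ} (hst : s ≠ t)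
    (ha : 0 < a) (hb : 0 < b) (hab : a + b = 1) :
    A * (Real.exp (a * s + b * t) - 1) + B * (Real.exp (-(a * s + b * t)) - 1) <
      a * (A * (Real.exp s - 1) + B * (Real.exp (-s) - 1)) +
      b * (A * (Real.exp t - 1) + B * (Real.exp (-t) - 1)) := by
  have h1 := strictConvexOn_exp.2 (Set.mem_univ s) (Set.mem_univ t) hst ha hb hab
  have h2 := strictConvexOn_exp.2 (Set.mem_univ (-s)) (Set.mem_univ (-t))
    (fun h => hst (neg_injective h)) ha hb hab
  simp only [smul_eq_mul] at h1 h2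
  rw [show a * -s + b * -t = -(a * s + b * t) by ring] at h2
  have h3 := mul_lt_mul_of_pos_left h1 hA
  have h4 := mul_lt_mul_of_pos_left h2 hB
  have hb' : b = 1 - a := by linarith
  subst hb'
  nlinarith

lemma term_le {A B : ℝ} (hA : 0 < A) (hB : 0 < B) {s t a b : ℝ}
    (ha : 0 ≤ a) (hb : 0 ≤ b) (hab : a + b = 1) :
    A * (Real.exp (a * s + b * t) - 1) + B * (Real.exp (-(a * s + b * t)) - 1) ≤
      a * (A * (Real.exp s - 1) + B * (Real.exp (-s) - 1)) +
      b * (A * (Real.exp t - 1) + B * (Real.exp (-t) - 1)) := by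
  have hb' : b = 1 - a := by linarith
  subst hb'
  rcases ha.eq_or_lt with rfl | ha
  · simp
  rcases hb.eq_or_lt with hb | hb
  · have : a = 1 := by linarith
    subst this
    simp
  by_cases hst : s = t
  · subst hst
    rw [show a * s + (1 - a) * s = s by ring]
    exact le_of_eq (by ring)
  · exact (term_strict hA hB hst ha hb hab).le

lemma exists_dotv_ne {N M : ℕ} (v : Fin M → Fin N → ℝ) (α : Fin N → ℝ)
    (h : α ∈ Submodule.span ℝ (Set.range v)) (h0 : α ≠ 0) : ∃ j, dotv (v j) α ≠ 0 := by
  by_contra! hc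
  have key : dotv α α = 0 := by
    refine Submodule.span_induction (p := fun y _ => dotv y α = 0) ?_ ?_ ?_ ?_ h
    · rintro _ ⟨j, rfl⟩
      exact hc j
    · simp [dotv]
    · intro y z _ _ hy hz
      simp only [dotv, Pi.add_apply, add_mul, Finset.sum_add_distrib] at *
      rw [hy, hz, add_zero]
    · intro c y _ hy
      simp only [dotv, Pi.smul_apply, smul_eq_mul, mul_assoc, ← Finset.mul_sum] at *
      rw [hy, mul_zero]
  apply h0
  funext i
  have := (Finset.sum_eq_zero_iff_of_nonneg (fun i _ => mul_self_nonneg (α i))).1 key i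
    (Finset.mem_univ i)
  simpa using this

/-- for a positive state `x` and positive rates, `p ↦ H(p,x)` is convex on
`ℝ^N` and strictly convex in every nonzero stoichiometric direction `α ∈ G`. -/
theorem stmt4 {N M : ℕ} (νp νm : Fin M → Fin N → ℕ) (kp km : Fin M → ℝ)
    (hkp : ∀ j, 0 < kp j) (hkm : ∀ j, 0 < km j)
    (x : Fin N → ℝ) (hx : ∀ i, 0 < x i) :
    ConvexOn ℝ Set.univ (fun p => Ham νp νm kp km p x) ∧
    (∀ p α : Fin N → ℝ, α ∈ Submodule.span ℝ (Set.range (nuv νp νm)) → α ≠ 0 →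
      StrictConvexOn ℝ Set.univ (fun t : ℝ => Ham νp νm kp km (p + t • α) x)) := by
  have hA : ∀ j, 0 < PhiP νp kp x j := fun j =>
    mul_pos (hkp j) (Finset.prod_pos fun i _ => pow_pos (hx i) _)
  have hB : ∀ j, 0 < PhiM νm km x j := fun j =>
    mul_pos (hkm j) (Finset.prod_pos fun i _ => pow_pos (hx i) _)
  refine ⟨⟨convex_univ, ?_⟩, ?_⟩
  · intro p _ q _ a b ha hb hab
    simp only [Ham, smul_eq_mul, Finset.mul_sum, ← Finset.sum_add_distrib, dotv_comb]
    exact Finset.sum_le_sum fun j _ => term_le (hA j) (hB j) ha hb hab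
  · intro p α hα h0
    refine ⟨convex_univ, ?_⟩
    intro s _ t _ hst a b ha hb hab
    obtain ⟨j₀, hj₀⟩ := exists_dotv_ne _ α hα h0
    have hcomb : p + (a • s + b • t) • α = a • (p + s • α) + b • (p + t • α) := by
      have hb' : b = 1 - a := by linarith
      subst hb'
      funext i
      simp only [Pi.add_apply, Pi.smul_apply, smul_eq_mul]
      ring
    simp only [hcomb]
    simp only [Ham, smul_eq_mul, Finset.mul_sum, ← Finset.sum_add_distrib, dotv_comb]
    refine Finset.sum_lt_sum (fun j _ => term_le (hA j) (hB j) ha.le hb.le hab)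
      ⟨j₀, Finset.mem_univ _, term_strict (hA j₀) (hB j₀) ?_ ha hb hab⟩
    intro h
    have e : ∀ r : ℝ, dotv (nuv νp νm j₀) (p + r • α)
        = dotv (nuv νp νm j₀) p + r * dotv (nuv νp νm j₀) α := by
      intro r
      have := dotv_comb (nuv νp νm j₀) p α 1 r
      simpa using this
    rw [e, e] at h
    exact hst (mul_right_cancel₀ hj₀ (add_left_cancel h))
end

section
/- Fix x ∈ ℝ^N with all components strictly positive and assume k⁺_j > 0 and k⁻_j > 0 for every j. Then for s ∈ ℝ^N the following are equivalent: (i) p·s ≤ H(p,x) for every p ∈ ℝ^N (equivalently, the Lagrangian L(s,x) := sup_{p}(p·s − H(p,x)) equals 0); (ii) s = R(x) = Σ_{j=1}^M ν_j (Φ⁺_j(x) − Φ⁻_j(x)). In other words, the zero-cost velocities of the Lagrangian are exactly the reaction rate equation velocities. -/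
open scoped BigOperators

/-- for a positive state `x` and positive rates, `p·s ≤ H(p,x)` for all `p`
(equivalently `L(s,x) = 0`) if and only if `s = R(x)`: the zero-cost velocities of the
Lagrangian are exactly the RRE velocities. -/
theorem stmt6 {N M : ℕ} (νp νm : Fin M → Fin N → ℕ) (kp km : Fin M → ℝ)
    (hkp : ∀ j, 0 < kp j) (hkm : ∀ j, 0 < km j)
    (x : Fin N → ℝ) (hx : ∀ i, 0 < x i) (s : Fin N → ℝ) :
    (∀ p : Fin N → ℝ, dotv p s ≤ Ham νp νm kp km p x) ↔ s = RRE νp νm kp km x := by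
  constructor
  · intro h
    funext i
    have hd : ∀ (a : Fin N → ℝ) (t : ℝ), dotv a (Pi.single i t) = a i * t := by
      intro a t
      simp [dotv, Pi.single_apply]
    have hd' : ∀ t : ℝ, dotv (Pi.single i t) s = t * s i := by
      intro t
      simp [dotv, Pi.single_apply]
    let g : ℝ → ℝ := fun t => (∑ j, (PhiP νp kp x j * (Real.exp (nuv νp νm j i * t) - 1)
      + PhiM νm km x j * (Real.exp (-(nuv νp νm j i * t)) - 1))) - t * s i
    have hg0 : g 0 = 0 := by simp [g]
    have hmin : IsLocalMin g 0 := by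
      refine Filter.Eventually.of_forall fun t => ?_
      rw [hg0]
      have := h (Pi.single i t)
      rw [hd'] at this
      simp only [Ham, hd] at this
      simp only [g]
      linarith
    have hder : HasDerivAt g (RRE νp νm kp km x i - s i) 0 := by
      have h1 : HasDerivAt (fun t : ℝ => t * s i) (s i) 0 := by
        simpa using (hasDerivAt_id (0 : ℝ)).mul_const (s i)
      refine HasDerivAt.sub ?_ h1
      unfold RRE
      refine HasDerivAt.fun_sum fun j _ => ?_
      have h2 : HasDerivAt (fun t : ℝ => nuv νp νm j i * t) (nuv νp νm j i) 0 := by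
        simpa using (hasDerivAt_id (0 : ℝ)).const_mul (nuv νp νm j i)
      have h3 := ((h2.exp.sub_const 1).const_mul (PhiP νp kp x j)).fun_add
        ((h2.fun_neg.exp.sub_const 1).const_mul (PhiM νm km x j))
      convert h3 using 1
      simp
      ring
    have := hmin.hasDerivAt_eq_zero hder
    linarith
  · rintro rfl p
    have e : dotv p (RRE νp νm kp km x)
        = ∑ j, dotv (nuv νp νm j) p * (PhiP νp kp x j - PhiM νm km x j) := by
      simp only [dotv, RRE, Finset.mul_sum, Finset.sum_mul]
      rw [Finset.sum_comm]
      refine Finset.sum_congr rfl fun j _ => Finset.sum_congr rfl fun i _ => ?_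
      ring
    rw [e]
    unfold Ham
    refine Finset.sum_le_sum fun j _ => ?_
    have hP : 0 ≤ PhiP νp kp x j :=
      mul_nonneg (hkp j).le (Finset.prod_nonneg fun i _ => pow_nonneg (hx i).le _)
    have hM : 0 ≤ PhiM νm km x j :=
      mul_nonneg (hkm j).le (Finset.prod_nonneg fun i _ => pow_nonneg (hx i).le _)
    have e1 := Real.add_one_le_exp (dotv (nuv νp νm j) p)
    have e2 := Real.add_one_le_exp (-(dotv (nuv νp νm j) p))
    have f1 := mul_nonneg hP (sub_nonneg.2 e1)
    have f2 := mul_nonneg hM (sub_nonneg.2 e2)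
    linarith
end

section
/- Let U ⊆ ℝ^N be open, and let H : ℝ^N × U → ℝ be such that for each x ∈ U the map p ↦ H(p,x) is twice continuously differentiable and convex, with H(0,x) = 0 for all x ∈ U. Let ψ : U → ℝ be differentiable with H(∇ψ(x), x) = 0 for all x ∈ U. Define W(x) := ∫₀¹ ∇_p H(θ∇ψ(x), x) dθ and K(x) := ∫₀¹ (1−θ) ∇²_{pp} H(θ∇ψ(x), x) dθ. Then for every x ∈ U: (a) ∇_p H(0,x) = W(x) − K(x)∇ψ(x) (conservative–dissipative decomposition); (b) ⟨W(x), ∇ψ(x)⟩ = 0; (c) K(x) is a symmetric positive semidefinite matrix. -/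
open scoped BigOperators

/-- The continuous linear functional `v ↦ g ⬝ v` on `Fin N → ℝ`. -/
noncomputable def dotCLM {N : ℕ} (g : Fin N → ℝ) : (Fin N → ℝ) →L[ℝ] ℝ :=
  ∑ i, g i • (ContinuousLinearMap.proj i : (Fin N → ℝ) →L[ℝ] ℝ)

/-- conservative–dissipative decomposition.  Let `H(p,x)` be `C²` and convex
in `p` with `H(0,x) = 0`, let `ψ` be differentiable with gradient `gψ` solving the
stationary Hamilton–Jacobi equation `H(∇ψ(x),x) = 0`, and let
`W(x) = ∫₀¹ ∇_p H(θ∇ψ(x),x) dθ`, `K(x) = ∫₀¹ (1−θ)∇²_{pp} H(θ∇ψ(x),x) dθ`.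
Then (a) `∇_p H(0,x) = W(x) − K(x)∇ψ(x)`, (b) `⟨W(x),∇ψ(x)⟩ = 0`, (c) `K(x)` is a
symmetric positive semidefinite matrix.  The functions `Hp` and `Hpp` are the gradient
and Hessian of `H` in `p`, characterized by directional derivatives. -/
theorem stmt7 {N : ℕ} (U : Set (Fin N → ℝ)) (hU : IsOpen U)
    (H : (Fin N → ℝ) → (Fin N → ℝ) → ℝ)
    (Hp : (Fin N → ℝ) → (Fin N → ℝ) → (Fin N → ℝ))
    (Hpp : (Fin N → ℝ) → (Fin N → ℝ) → Matrix (Fin N) (Fin N) ℝ)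
    (hC2 : ∀ x ∈ U, ContDiff ℝ 2 (fun p => H p x))
    (hconv : ∀ x ∈ U, ConvexOn ℝ Set.univ (fun p => H p x))
    (hH0 : ∀ x ∈ U, H 0 x = 0)
    (hHp : ∀ x ∈ U, ∀ p v : Fin N → ℝ,
      HasDerivAt (fun t : ℝ => H (p + t • v) x) (dotv (Hp p x) v) 0)
    (hHpp : ∀ x ∈ U, ∀ p v w : Fin N → ℝ,
      HasDerivAt (fun t : ℝ => dotv (Hp (p + t • w) x) v)
        (∑ i, ∑ k, v i * Hpp p x i k * w k) 0)
    (ψ : (Fin N → ℝ) → ℝ) (gψ : (Fin N → ℝ) → (Fin N → ℝ))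
    (hgψ : ∀ x ∈ U, HasFDerivAt ψ (dotCLM (gψ x)) x)
    (hHJ : ∀ x ∈ U, H (gψ x) x = 0) :
    ∀ x ∈ U,
      (∀ i, Hp 0 x i =
        (∫ θ in (0:ℝ)..1, Hp (θ • gψ x) x i)
        - ∑ k, (∫ θ in (0:ℝ)..1, (1 - θ) * Hpp (θ • gψ x) x i k) * gψ x k) ∧
      (∑ i, (∫ θ in (0:ℝ)..1, Hp (θ • gψ x) x i) * gψ x i = 0) ∧
      (∀ i k, (∫ θ in (0:ℝ)..1, (1 - θ) * Hpp (θ • gψ x) x i k)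
            = (∫ θ in (0:ℝ)..1, (1 - θ) * Hpp (θ • gψ x) x k i)) ∧
      (∀ v : Fin N → ℝ,
        0 ≤ ∑ i, ∑ k,
          v i * (∫ θ in (0:ℝ)..1, (1 - θ) * Hpp (θ • gψ x) x i k) * v k) := by
  intro x hx
  set q := gψ x with hq
  set f : (Fin N → ℝ) → ℝ := fun p => H p x with hf
  have hf2 : ContDiff ℝ 2 f := hC2 x hx
  have hcv : ConvexOn ℝ Set.univ f := hconv x hx
  have hD1 : ContDiff ℝ 1 (fderiv ℝ f) := hf2.fderiv_right (by norm_num)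
  have hfd : ∀ p, HasFDerivAt f (fderiv ℝ f p) p := fun p =>
    (hf2.differentiable (by norm_num) p).hasFDerivAt
  have hDd : ∀ p, HasFDerivAt (fderiv ℝ f) (fderiv ℝ (fderiv ℝ f) p) p := fun p =>
    (hD1.differentiable (by norm_num) p).hasFDerivAt
  have hDc : Continuous (fderiv ℝ f) := hD1.continuous
  have hD2c : Continuous (fderiv ℝ (fderiv ℝ f)) := hD1.continuous_fderiv (by norm_num)
  have hline : ∀ (p v : Fin N → ℝ) (t : ℝ), HasDerivAt (fun t : ℝ => p + t • v) v t := by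
    intro p v t
    simpa using ((hasDerivAt_id t).smul_const v).const_add p
  have hfl : ∀ (p v : Fin N → ℝ) (t : ℝ),
      HasDerivAt (fun t : ℝ => f (p + t • v)) (fderiv ℝ f (p + t • v) v) t := fun p v t =>
    (hfd _).comp_hasDerivAt t (hline p v t)
  have hDl : ∀ (p v w : Fin N → ℝ) (t : ℝ),
      HasDerivAt (fun t : ℝ => fderiv ℝ f (p + t • w) v)
        (fderiv ℝ (fderiv ℝ f) (p + t • w) w v) t := by
    intro p v w t
    have h := (hDd (p + t • w)).comp_hasDerivAt t (hline p w t)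
    simpa using h.clm_apply (hasDerivAt_const t v)
  have h1 : ∀ p v, dotv (Hp p x) v = fderiv ℝ f p v := by
    intro p v
    have h := hfl p v 0
    simp only [zero_smul, add_zero] at h
    exact (hHp x hx p v).unique h
  have h2 : ∀ p v w, ∑ i, ∑ k, v i * Hpp p x i k * w k = fderiv ℝ (fderiv ℝ f) p w v := by
    intro p v w
    have h := hDl p v w 0
    simp only [zero_smul, add_zero] at h
    have h' := hHpp x hx p v w
    simp only [h1] at h'
    exact h'.unique h
  have h1' : ∀ p i, Hp p x i = fderiv ℝ f p (Pi.single i 1) := by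
    intro p i
    rw [← h1]; simp [dotv, Pi.single_apply]
  have h2' : ∀ p i k, Hpp p x i k = fderiv ℝ (fderiv ℝ f) p (Pi.single k 1) (Pi.single i 1) := by
    intro p i k
    rw [← h2]; simp [Pi.single_apply]
  have hsym : ∀ p v w, fderiv ℝ (fderiv ℝ f) p v w = fderiv ℝ (fderiv ℝ f) p w v := by
    intro p v w
    exact (hf2.contDiffAt.isSymmSndFDerivAt (by simp)) v w
  have hpos : ∀ p v, 0 ≤ fderiv ℝ (fderiv ℝ f) p v v := by
    intro p v
    have hc : ConvexOn ℝ Set.univ (fun t : ℝ => f (p + t • v)) := by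
      have := hcv.comp_affineMap (AffineMap.lineMap p (p + v) : ℝ →ᵃ[ℝ] (Fin N → ℝ))
      simpa [Function.comp_def, AffineMap.lineMap_apply, add_comm] using this
    have hm := hc.monotoneOn_deriv (fun t _ => (hfl p v t).differentiableAt)
    have hde : deriv (fun t : ℝ => f (p + t • v)) = fun t => fderiv ℝ f (p + t • v) v :=
      funext fun t => (hfl p v t).deriv
    rw [hde] at hm
    have h := hDl p v v 0
    simp only [zero_smul, add_zero] at h
    rw [← h.deriv]
    exact (monotoneOn_univ.1 hm).deriv_nonneg
  have cHp : ∀ i, Continuous (fun θ : ℝ => Hp (θ • q) x i) := by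
    intro i; simp only [h1']; fun_prop
  have cHpp : ∀ i k, Continuous (fun θ : ℝ => Hpp (θ • q) x i k) := by
    intro i k; simp only [h2']
    exact ((hD2c.comp (by fun_prop : Continuous fun θ : ℝ => θ • q)).clm_apply
      continuous_const).clm_apply continuous_const
  have iHpp : ∀ i k, IntervalIntegrable (fun θ : ℝ => (1 - θ) * Hpp (θ • q) x i k)
      MeasureTheory.volume 0 1 := fun i k =>
    (Continuous.mul (by fun_prop) (cHpp i k)).intervalIntegrable _ _
  refine ⟨?_, ?_, ?_, ?_⟩
  · intro i
    have hd : ∀ θ : ℝ, HasDerivAt (fun θ : ℝ => Hp (θ • q) x i)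
        (∑ k, Hpp (θ • q) x i k * q k) θ := by
      intro θ
      have h := hDl 0 (Pi.single i 1) q θ
      simp only [zero_add, ← h1', ← h2] at h
      simpa [Pi.single_apply] using h
    have hF : ∀ θ ∈ Set.uIcc (0:ℝ) 1, HasDerivAt (fun θ : ℝ => (1 - θ) * Hp (θ • q) x i)
        (∑ k, (1 - θ) * Hpp (θ • q) x i k * q k - Hp (θ • q) x i) θ := by
      intro θ _
      have h := ((hasDerivAt_id θ).const_sub 1).mul (hd θ)
      have e : ∑ k, (1 - θ) * Hpp (θ • q) x i k * q k - Hp (θ • q) x i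
          = -1 * Hp (θ • q) x i + (1 - θ) * ∑ k, Hpp (θ • q) x i k * q k := by
        simp only [Finset.mul_sum, mul_assoc]
        ring
      rw [e]
      exact h
    have is : IntervalIntegrable (fun θ : ℝ => ∑ k, (1 - θ) * Hpp (θ • q) x i k * q k)
        MeasureTheory.volume 0 1 :=
      (continuous_finsetSum _ fun k _ =>
        ((Continuous.mul (by fun_prop) (cHpp i k)).mul continuous_const)).intervalIntegrable _ _
    have ip := (cHp i).intervalIntegrable (μ := MeasureTheory.volume) 0 1
    have h := intervalIntegral.integral_eq_sub_of_hasDerivAt hF (is.sub ip)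
    rw [intervalIntegral.integral_sub is ip, intervalIntegral.integral_finsetSum
      (fun k _ => (iHpp i k).mul_const _)] at h
    simp only [intervalIntegral.integral_mul_const, zero_smul] at h
    linarith
  · have h := intervalIntegral.integral_eq_sub_of_hasDerivAt (a := 0) (b := 1)
      (fun θ _ => hfl 0 q θ) (by
        apply Continuous.intervalIntegrable; fun_prop)
    simp only [zero_add, ← h1, dotv] at h
    rw [intervalIntegral.integral_finsetSum
      (fun k _ => ((cHp k).intervalIntegrable _ _).mul_const _)] at h
    simp only [intervalIntegral.integral_mul_const, zero_smul, one_smul] at h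
    rw [h]
    simp [hf, hH0 x hx, hq, hHJ x hx]
  · intro i k
    simp only [h2', hsym _ (Pi.single k 1) (Pi.single i 1)]
  · intro v
    have h : ∑ i, ∑ k, v i * (∫ θ in (0:ℝ)..1, (1 - θ) * Hpp (θ • q) x i k) * v k
        = ∫ θ in (0:ℝ)..1, ∑ i, ∑ k, v i * ((1 - θ) * Hpp (θ • q) x i k) * v k := by
      rw [intervalIntegral.integral_finsetSum]
      · refine Finset.sum_congr rfl fun i _ => ?_
        rw [intervalIntegral.integral_finsetSum
          (fun k _ => ((iHpp i k).const_mul _).mul_const _)]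
        simp only [intervalIntegral.integral_mul_const, intervalIntegral.integral_const_mul]
      · intro i _
        exact (continuous_finsetSum _ fun k _ => (continuous_const.mul
          (Continuous.mul (by fun_prop) (cHpp i k))).mul continuous_const).intervalIntegrable _ _
    rw [h]
    apply intervalIntegral.integral_nonneg (by norm_num)
    intro θ hθ
    have e : ∑ i, ∑ k, v i * ((1 - θ) * Hpp (θ • q) x i k) * v k
        = (1 - θ) * ∑ i, ∑ k, v i * Hpp (θ • q) x i k * v k := by
      simp only [Finset.mul_sum]
      refine Finset.sum_congr rfl fun i _ => Finset.sum_congr rfl fun k _ => by ring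
    rw [e, h2]
    exact mul_nonneg (by linarith [hθ.2]) (hpos _ _)
end

section
/- Let U ⊆ ℝ^N be open, H : ℝ^N × U → ℝ with p ↦ H(p,x) twice continuously differentiable and convex for each x ∈ U and H(0,x) = 0 on U, and let ψ : U → ℝ be continuously differentiable with H(∇ψ(x), x) = 0 on U. Let K(x) := ∫₀¹ (1−θ) ∇²_{pp} H(θ∇ψ(x), x) dθ. Let x : [0,T] → U be differentiable with ẋ(t) = ∇_p H(0, x(t)) for all t, and let φ : ℝ → ℝ be differentiable with φ′ ≥ 0. Then for every t ∈ [0,T], d/dt [φ(ψ(x(t)))] = − φ′(ψ(x(t))) ⟨K(x(t)) ∇ψ(x(t)), ∇ψ(x(t))⟩ ≤ 0. In particular, every nondecreasing function of ψ is a Lyapunov function for the dynamics ẋ = ∇_p H(0,x). -/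
open scoped BigOperators

theorem aux_d {E : Type*} [NormedAddCommGroup E] [NormedSpace ℝ E]
    (A : E → (E →L[ℝ] ℝ)) (A' : E →L[ℝ] (E →L[ℝ] ℝ)) (c : ℝ → E) (c' : E) (t : ℝ)
    (hA : HasFDerivAt A A' (c t)) (hc : HasDerivAt c c' t) (v : E) :
    HasDerivAt (fun s => A (c s) v) (A' c' v) t := by
  have h1 : HasDerivAt (fun s => A (c s)) (A' c') t := hA.comp_hasDerivAt t hc
  exact (ContinuousLinearMap.apply ℝ ℝ v).hasFDerivAt.comp_hasDerivAt t h1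

theorem aux_key {N : ℕ} (f : (Fin N → ℝ) → ℝ) (Hp : (Fin N → ℝ) → (Fin N → ℝ))
    (Hpp : (Fin N → ℝ) → Matrix (Fin N) (Fin N) ℝ)
    (hC2 : ContDiff ℝ 2 f)
    (hHp : ∀ p v : Fin N → ℝ, HasDerivAt (fun t : ℝ => f (p + t • v)) (dotv (Hp p) v) 0)
    (hHpp : ∀ p v w : Fin N → ℝ,
      HasDerivAt (fun t : ℝ => dotv (Hp (p + t • w)) v)
        (∑ i, ∑ k, v i * Hpp p i k * w k) 0)
    (g : Fin N → ℝ) (h0 : f 0 = 0) (h1 : f g = 0) :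
    ∑ i, ∑ k, g i * (∫ θ in (0:ℝ)..1, (1 - θ) * Hpp (θ • g) i k) * g k
      = - dotv (Hp 0) g := by
  have hline : ∀ p w : Fin N → ℝ, HasDerivAt (fun t : ℝ => p + t • w) w 0 := by
    intro p w
    simpa using ((hasDerivAt_id (0:ℝ)).smul_const w).const_add p
  have hF : ∀ p v, fderiv ℝ f p v = dotv (Hp p) v := by
    intro p v
    have hd : HasFDerivAt f (fderiv ℝ f p) (p + (0:ℝ) • v) := by
      simpa using (hC2.differentiable (by norm_num) p).hasFDerivAt
    exact (hd.comp_hasDerivAt (0:ℝ) (hline p v)).unique (hHp p v)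
  have hC1 : ContDiff ℝ 1 (fderiv ℝ f) := hC2.fderiv_right (by norm_num)
  have hF2 : ∀ p v w, fderiv ℝ (fderiv ℝ f) p w v = ∑ i, ∑ k, v i * Hpp p i k * w k := by
    intro p v w
    have hd : HasFDerivAt (fderiv ℝ f) (fderiv ℝ (fderiv ℝ f) p) (p + (0:ℝ) • w) := by
      simpa using (hC1.differentiable (by norm_num) p).hasFDerivAt
    have h2 := aux_d (fderiv ℝ f) _ (fun t : ℝ => p + t • w) w 0 hd (hline p w) v
    have h3 := hHpp p v w
    simp only [← hF] at h3
    exact h2.unique h3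
  have hent : ∀ p i k, Hpp p i k = fderiv ℝ (fderiv ℝ f) p (Pi.single k 1) (Pi.single i 1) := by
    intro p i k
    rw [hF2]
    simp [Pi.single_apply]
  have hc2 : Continuous (fderiv ℝ (fderiv ℝ f)) := hC1.continuous_fderiv (by norm_num)
  have hcont : ∀ i k, Continuous (fun θ : ℝ => (1 - θ) * Hpp (θ • g) i k) := by
    intro i k
    simp only [hent]
    have : Continuous (fun θ : ℝ => fderiv ℝ (fderiv ℝ f) (θ • g)) :=
      hc2.comp (by fun_prop)
    fun_prop
  have hsum : ∑ i, ∑ k, g i * (∫ θ in (0:ℝ)..1, (1 - θ) * Hpp (θ • g) i k) * g k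
      = ∫ θ in (0:ℝ)..1, ∑ i, ∑ k, g i * ((1 - θ) * Hpp (θ • g) i k) * g k := by
    rw [intervalIntegral.integral_finset_sum]
    · refine Finset.sum_congr rfl fun i _ => ?_
      rw [intervalIntegral.integral_finset_sum]
      · refine Finset.sum_congr rfl fun k _ => ?_
        rw [intervalIntegral.integral_mul_const, intervalIntegral.integral_const_mul]
      · intro k _
        exact (((hcont i k).const_mul (g i)).mul_const (g k)).intervalIntegrable _ _
    · intro i _
      exact (continuous_finset_sum _ fun k _ =>
        ((hcont i k).const_mul (g i)).mul_const (g k)).intervalIntegrable _ _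
  rw [hsum]
  have hG : ∀ θ : ℝ, HasDerivAt (fun θ : ℝ => (1 - θ) * fderiv ℝ f (θ • g) g + f (θ • g))
      (∑ i, ∑ k, g i * ((1 - θ) * Hpp (θ • g) i k) * g k) θ := by
    intro θ
    have hl : HasDerivAt (fun t : ℝ => t • g) g θ := by
      simpa using (hasDerivAt_id θ).smul_const g
    have e1 := ((hC2.differentiable (by norm_num) (θ • g)).hasFDerivAt).comp_hasDerivAt θ hl
    have e2 := aux_d (fderiv ℝ f) _ (fun t : ℝ => t • g) g θ
      (hC1.differentiable (by norm_num) (θ • g)).hasFDerivAt hl g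
    have e3 := (((hasDerivAt_id θ).const_sub 1).mul e2).add e1
    refine e3.congr_deriv ?_
    have : ∑ i, ∑ k, g i * ((1 - θ) * Hpp (θ • g) i k) * g k
        = (1 - θ) * fderiv ℝ (fderiv ℝ f) (θ • g) g g := by
      rw [hF2, Finset.mul_sum]
      refine Finset.sum_congr rfl fun i _ => ?_
      rw [Finset.mul_sum]
      refine Finset.sum_congr rfl fun k _ => ?_
      ring
    rw [this]
    simp
  rw [intervalIntegral.integral_eq_sub_of_hasDerivAt (fun θ _ => hG θ)]
  · simp [h0, h1, hF]
  · exact (continuous_finset_sum _ fun i _ => continuous_finset_sum _ fun k _ =>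
        ((hcont i k).const_mul (g i)).mul_const (g k)).intervalIntegrable _ _

theorem aux_nonpos {N : ℕ} (f : (Fin N → ℝ) → ℝ) (hc : ConvexOn ℝ Set.univ f)
    (g : Fin N → ℝ) (h0 : f 0 = 0) (h1 : f g = 0) (d : ℝ)
    (hd : HasDerivAt (fun t : ℝ => f (0 + t • g)) d 0) : d ≤ 0 := by
  have hcv : ConvexOn ℝ Set.univ (fun t : ℝ => f (0 + t • g)) := by
    refine ⟨convex_univ, fun a _ b _ s r hs hr hsr => ?_⟩
    have := hc.2 (Set.mem_univ (a • g)) (Set.mem_univ (b • g)) hs hr hsr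
    simpa [add_smul, mul_smul] using this
  have := hcv.le_slope_of_hasDerivAt (Set.mem_univ (0:ℝ)) (Set.mem_univ (1:ℝ)) one_pos hd
  simpa [slope, h0, h1] using this

/-- energy dissipation for the dynamics `ẋ = ∇_p H(0,x)`.  Let `H(p,x)` be
`C²` and convex in `p` with `H(0,x) = 0`, `ψ` a `C¹` stationary solution of the
Hamilton–Jacobi equation `H(∇ψ(x),x) = 0` with gradient `gψ`, and
`K(x) = ∫₀¹ (1−θ)∇²_{pp}H(θ∇ψ(x),x) dθ`.  If `ẋ(t) = ∇_p H(0,x(t))` on `[0,T]` and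
`φ` is differentiable with `φ' ≥ 0`, then for every `t ∈ [0,T]`,
`d/dt φ(ψ(x(t))) = −φ'(ψ(x(t))) ⟨K(x(t))∇ψ(x(t)), ∇ψ(x(t))⟩ ≤ 0`. -/
theorem stmt8 {N : ℕ} (U : Set (Fin N → ℝ)) (hU : IsOpen U)
    (H : (Fin N → ℝ) → (Fin N → ℝ) → ℝ)
    (Hp : (Fin N → ℝ) → (Fin N → ℝ) → (Fin N → ℝ))
    (Hpp : (Fin N → ℝ) → (Fin N → ℝ) → Matrix (Fin N) (Fin N) ℝ)
    (hC2 : ∀ x ∈ U, ContDiff ℝ 2 (fun p => H p x))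
    (hconv : ∀ x ∈ U, ConvexOn ℝ Set.univ (fun p => H p x))
    (hH0 : ∀ x ∈ U, H 0 x = 0)
    (hHp : ∀ x ∈ U, ∀ p v : Fin N → ℝ,
      HasDerivAt (fun t : ℝ => H (p + t • v) x) (dotv (Hp p x) v) 0)
    (hHpp : ∀ x ∈ U, ∀ p v w : Fin N → ℝ,
      HasDerivAt (fun t : ℝ => dotv (Hp (p + t • w) x) v)
        (∑ i, ∑ k, v i * Hpp p x i k * w k) 0)
    (ψ : (Fin N → ℝ) → ℝ) (gψ : (Fin N → ℝ) → (Fin N → ℝ))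
    (hgψ : ∀ x ∈ U, HasFDerivAt ψ (dotCLM (gψ x)) x)
    (hgc : ContinuousOn gψ U)
    (hHJ : ∀ x ∈ U, H (gψ x) x = 0)
    (T : ℝ) (x : ℝ → Fin N → ℝ)
    (hxmem : ∀ t ∈ Set.Icc (0:ℝ) T, x t ∈ U)
    (hxode : ∀ t ∈ Set.Icc (0:ℝ) T,
      HasDerivWithinAt x (Hp 0 (x t)) (Set.Icc (0:ℝ) T) t)
    (φ : ℝ → ℝ) (dφ : ℝ → ℝ)
    (hφ : ∀ y, HasDerivAt φ (dφ y) y) (hφ' : ∀ y, 0 ≤ dφ y) :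
    ∀ t ∈ Set.Icc (0:ℝ) T,
      HasDerivWithinAt (fun τ => φ (ψ (x τ)))
        (-(dφ (ψ (x t)) * ∑ i, ∑ k, gψ (x t) i
            * (∫ θ in (0:ℝ)..1, (1 - θ) * Hpp (θ • gψ (x t)) (x t) i k)
            * gψ (x t) k))
        (Set.Icc (0:ℝ) T) t ∧
      (-(dφ (ψ (x t)) * ∑ i, ∑ k, gψ (x t) i
          * (∫ θ in (0:ℝ)..1, (1 - θ) * Hpp (θ • gψ (x t)) (x t) i k)
          * gψ (x t) k)) ≤ 0 := by
  intro t ht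
  have hy := hxmem t ht
  have key := aux_key (fun p => H p (x t)) (fun p => Hp p (x t)) (fun p => Hpp p (x t))
    (hC2 _ hy) (hHp _ hy) (hHpp _ hy) (gψ (x t)) (hH0 _ hy) (hHJ _ hy)
  have hnp := aux_nonpos (fun p => H p (x t)) (hconv _ hy) (gψ (x t)) (hH0 _ hy) (hHJ _ hy) _
    (hHp _ hy 0 (gψ (x t)))
  rw [key]
  refine ⟨?_, ?_⟩
  · have e1 := (hgψ _ hy).comp_hasDerivWithinAt t (hxode t ht)
    have e2 := (hφ (ψ (x t))).comp_hasDerivWithinAt t e1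
    refine e2.congr_deriv ?_
    simp [dotCLM, dotv, mul_comm]
  · have := mul_nonneg (hφ' (ψ (x t))) (neg_nonneg.mpr hnp)
    linarith
end

section
/- Let x^s ∈ ℝ^N have all components strictly positive. Then the following are equivalent: (i) x^s is complex balanced; (ii) the relative entropy ψ(x) := Σ_{i=1}^N (x_i log(x_i/x^s_i) − x_i + x^s_i) is a stationary solution of the Hamilton–Jacobi equation, i.e. H(∇ψ(x), x) = 0 for every x ∈ ℝ^N with all components strictly positive, where ∇ψ(x) is the vector with components log(x_i/x^s_i). -/
open scoped BigOperators

/-- The polynomial encoding the Hamiltonian. -/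
noncomputable def cbPoly {N M : ℕ} (a b : Fin M → Fin N → ℕ) (P Q : Fin M → ℝ) :
    MvPolynomial (Fin N) ℝ :=
  ∑ j, (MvPolynomial.monomial (Finsupp.equivFunOnFinite.symm (a j)) (Q j - P j)
    + MvPolynomial.monomial (Finsupp.equivFunOnFinite.symm (b j)) (P j - Q j))

lemma cbPoly_coeff {N M : ℕ} (a b : Fin M → Fin N → ℕ) (P Q : Fin M → ℝ) (η : Fin N → ℕ) :
    (cbPoly a b P Q).coeff (Finsupp.equivFunOnFinite.symm η) =
    (∑ j ∈ Finset.univ.filter (fun j => a j = η), (Q j - P j))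
    + (∑ j ∈ Finset.univ.filter (fun j => b j = η), (P j - Q j)) := by
  classical
  unfold cbPoly
  rw [MvPolynomial.coeff_sum, Finset.sum_filter, Finset.sum_filter, ← Finset.sum_add_distrib]
  refine Finset.sum_congr rfl fun j _ => ?_
  simp only [MvPolynomial.coeff_add, MvPolynomial.coeff_monomial, EmbeddingLike.apply_eq_iff_eq]

lemma cbPoly_eval {N M : ℕ} (a b : Fin M → Fin N → ℕ) (P Q : Fin M → ℝ) (y : Fin N → ℝ) :
    MvPolynomial.eval y (cbPoly a b P Q) =
    ∑ j, ((Q j - P j) * ∏ i, y i ^ a j i + (P j - Q j) * ∏ i, y i ^ b j i) := by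
  unfold cbPoly
  rw [map_sum]
  refine Finset.sum_congr rfl fun j _ => ?_
  rw [map_add, MvPolynomial.eval_monomial, MvPolynomial.eval_monomial,
    Finsupp.prod_fintype _ _ (by simp), Finsupp.prod_fintype _ _ (by simp)]
  simp

lemma ham_eq {N M : ℕ} (νp νm : Fin M → Fin N → ℕ) (kp km : Fin M → ℝ)
    (xs : Fin N → ℝ) (hxs : ∀ i, 0 < xs i) (x : Fin N → ℝ) (hx : ∀ i, 0 < x i) :
    Ham νp νm kp km (fun i => Real.log (x i / xs i)) x =
    MvPolynomial.eval (fun i => x i / xs i)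
      (cbPoly νp νm (PhiP νp kp xs) (PhiM νm km xs)) := by
  rw [cbPoly_eval]
  unfold Ham
  refine Finset.sum_congr rfl fun j _ => ?_
  have hy : ∀ i, 0 < x i / xs i := fun i => div_pos (hx i) (hxs i)
  have hA : ∀ c : Fin N → ℕ, 0 < ∏ i, xs i ^ c i := fun c =>
    Finset.prod_pos fun i _ => pow_pos (hxs i) _
  have hB : ∀ c : Fin N → ℕ, 0 < ∏ i, (x i / xs i) ^ c i := fun c =>
    Finset.prod_pos fun i _ => pow_pos (hy i) _
  have hX : ∀ c : Fin N → ℕ, ∏ i, x i ^ c i = (∏ i, xs i ^ c i) * ∏ i, (x i / xs i) ^ c i := by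
    intro c
    rw [← Finset.prod_mul_distrib]
    refine Finset.prod_congr rfl fun i _ => ?_
    rw [← mul_pow, mul_div_cancel₀ _ (hxs i).ne']
  have he : Real.exp (dotv (nuv νp νm j) (fun i => Real.log (x i / xs i))) =
      (∏ i, (x i / xs i) ^ νm j i) / ∏ i, (x i / xs i) ^ νp j i := by
    unfold dotv nuv
    rw [Real.exp_sum, ← Finset.prod_div_distrib]
    refine Finset.prod_congr rfl fun i _ => ?_
    rw [sub_mul, Real.exp_sub, Real.exp_nat_mul, Real.exp_nat_mul, Real.exp_log (hy i)]
  rw [Real.exp_neg, he]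
  unfold PhiP PhiM
  rw [hX, hX]
  have h1 := (hB (νp j)).ne'
  have h2 := (hB (νm j)).ne'
  generalize (∏ i, (x i / xs i) ^ νp j i) = u at *
  generalize (∏ i, (x i / xs i) ^ νm j i) = v at *
  field_simp
  ring

/-- a positive state `xs` is complex balanced iff the relative entropy
`ψ(x) = Σ_i (x_i log(x_i/xs_i) − x_i + xs_i)`, whose gradient has components
`log(x_i/xs_i)`, is a stationary solution of the Hamilton–Jacobi equation:
`H(∇ψ(x), x) = 0` for every componentwise positive `x`. -/
theorem stmt9 {N M : ℕ} (νp νm : Fin M → Fin N → ℕ) (kp km : Fin M → ℝ)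
    (hkp : ∀ j, 0 ≤ kp j) (hkm : ∀ j, 0 ≤ km j)
    (xs : Fin N → ℝ) (hxs : ∀ i, 0 < xs i) :
    ComplexBalanced νp νm kp km xs ↔
      (∀ x : Fin N → ℝ, (∀ i, 0 < x i) →
        Ham νp νm kp km (fun i => Real.log (x i / xs i)) x = 0) := by
  have key : ComplexBalanced νp νm kp km xs ↔
      cbPoly νp νm (PhiP νp kp xs) (PhiM νm km xs) = 0 := by
    constructor
    · intro h
      ext d
      obtain ⟨η, rfl⟩ := Finsupp.equivFunOnFinite.symm.surjective d
      rw [cbPoly_coeff, MvPolynomial.coeff_zero]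
      by_cases hη : (∃ j, νp j = η) ∨ (∃ j, νm j = η)
      · exact h η hη
      · push Not at hη
        rw [Finset.filter_false_of_mem (fun j _ => hη.1 j),
          Finset.filter_false_of_mem (fun j _ => hη.2 j)]
        simp
    · intro h η _
      rw [← cbPoly_coeff, h, MvPolynomial.coeff_zero]
  rw [key]
  constructor
  · intro h x hx
    rw [ham_eq νp νm kp km xs hxs x hx, h, map_zero]
  · intro h
    refine MvPolynomial.funext_set (fun _ => Set.Ioi (0 : ℝ)) (fun _ => Set.Ioi_infinite 0) ?_
    intro y hy
    have hy' : ∀ i, 0 < y i := fun i => hy i (Set.mem_univ i)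
    have hx : ∀ i, 0 < y i * xs i := fun i => mul_pos (hy' i) (hxs i)
    have h3 := h (fun i => y i * xs i) hx
    rw [ham_eq νp νm kp km xs hxs _ hx] at h3
    have h4 : (fun i => y i * xs i / xs i) = y := by
      funext i
      exact mul_div_cancel_right₀ _ (hxs i).ne'
    rw [h4] at h3
    rw [h3, map_zero]
end

section
/- Let M ∈ ℕ, and for j = 1,…,M let Φ⁺_j > 0, Φ⁻_j > 0 be real numbers and ν_j ∈ ℝ^N vectors. Let q ∈ ℝ^N satisfy the stationary Hamilton–Jacobi relation Σ_{j=1}^M [Φ⁺_j(e^{ν_j·q} − 1) + Φ⁻_j(e^{−ν_j·q} − 1)] = 0. Define the total entropy production rate Ṡ_tot := Σ_j (Φ⁺_j − Φ⁻_j) log(Φ⁺_j/Φ⁻_j), the nonadiabatic part Ṡ_na := Σ_j [Φ⁺_j(e^{ν_j·q} − 1 − ν_j·q) + Φ⁻_j(e^{−ν_j·q} − 1 + ν_j·q)], and the adiabatic part Ṡ_a := Σ_j [KL(Φ⁺_j ‖ Φ⁻_j e^{−ν_j·q}) + KL(Φ⁻_j ‖ Φ⁺_j e^{ν_j·q})].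 Then Ṡ_tot = Ṡ_na + Ṡ_a, Ṡ_na ≥ 0, and Ṡ_a ≥ 0; in particular Ṡ_tot ≥ 0. -/
open scoped BigOperators

/-- Scalar relative entropy (Kullback–Leibler divergence) `KL(a‖b) = a log(a/b) − a + b`. -/
noncomputable def KLdiv (a b : ℝ) : ℝ := a * Real.log (a / b) - a + b

/-- decomposition of the total entropy production rate.  If the fluxes
`Φ⁺_j, Φ⁻_j > 0` and `q` satisfies the stationary Hamilton–Jacobi relation
`Σ_j [Φ⁺_j(e^{ν_j·q}−1) + Φ⁻_j(e^{−ν_j·q}−1)] = 0`, then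
`Ṡ_tot = Ṡ_na + Ṡ_a` with `Ṡ_na ≥ 0` and `Ṡ_a ≥ 0`; in particular `Ṡ_tot ≥ 0`. -/
theorem stmt10 {N M : ℕ} (Φp Φm : Fin M → ℝ)
    (hΦp : ∀ j, 0 < Φp j) (hΦm : ∀ j, 0 < Φm j)
    (ν : Fin M → Fin N → ℝ) (q : Fin N → ℝ)
    (hHJ : ∑ j, (Φp j * (Real.exp (dotv (ν j) q) - 1)
               + Φm j * (Real.exp (-(dotv (ν j) q)) - 1)) = 0) :
    ((∑ j, (Φp j - Φm j) * Real.log (Φp j / Φm j))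
        = (∑ j, (Φp j * (Real.exp (dotv (ν j) q) - 1 - dotv (ν j) q)
               + Φm j * (Real.exp (-(dotv (ν j) q)) - 1 + dotv (ν j) q)))
          + (∑ j, (KLdiv (Φp j) (Φm j * Real.exp (-(dotv (ν j) q)))
                 + KLdiv (Φm j) (Φp j * Real.exp (dotv (ν j) q))))) ∧
    (0 ≤ ∑ j, (Φp j * (Real.exp (dotv (ν j) q) - 1 - dotv (ν j) q)
             + Φm j * (Real.exp (-(dotv (ν j) q)) - 1 + dotv (ν j) q))) ∧
    (0 ≤ ∑ j, (KLdiv (Φp j) (Φm j * Real.exp (-(dotv (ν j) q)))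
             + KLdiv (Φm j) (Φp j * Real.exp (dotv (ν j) q)))) ∧
    (0 ≤ ∑ j, (Φp j - Φm j) * Real.log (Φp j / Φm j)) := by
  have hKL : ∀ a b : ℝ, 0 < a → 0 < b → 0 ≤ KLdiv a b := by
    intro a b ha hb
    unfold KLdiv
    have h := Real.log_le_sub_one_of_pos (div_pos hb ha)
    have h2 : Real.log (a / b) = - Real.log (b / a) := by
      rw [← Real.log_inv, inv_div]
    have h3 := mul_le_mul_of_nonneg_left h ha.le
    have h4 : a * (b / a - 1) = b - a := by field_simp
    rw [h2]
    linarith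
  have h1 : (∑ j, (Φp j - Φm j) * Real.log (Φp j / Φm j))
        = (∑ j, (Φp j * (Real.exp (dotv (ν j) q) - 1 - dotv (ν j) q)
               + Φm j * (Real.exp (-(dotv (ν j) q)) - 1 + dotv (ν j) q)))
          + (∑ j, (KLdiv (Φp j) (Φm j * Real.exp (-(dotv (ν j) q)))
                 + KLdiv (Φm j) (Φp j * Real.exp (dotv (ν j) q)))) := by
    rw [← Finset.sum_add_distrib]
    rw [← add_zero (∑ j, (Φp j - Φm j) * Real.log (Φp j / Φm j)),
      ← add_zero (∑ j, (Φp j - Φm j) * Real.log (Φp j / Φm j)), ← hHJ,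
      ← Finset.sum_add_distrib, ← Finset.sum_add_distrib]
    refine Finset.sum_congr rfl fun j _ => ?_
    have hp := (hΦp j).ne'
    have hm := (hΦm j).ne'
    unfold KLdiv
    rw [Real.log_div hp hm, Real.log_div hp (mul_ne_zero hm (Real.exp_ne_zero _)),
      Real.log_div hm (mul_ne_zero hp (Real.exp_ne_zero _)),
      Real.log_mul hm (Real.exp_ne_zero _), Real.log_mul hp (Real.exp_ne_zero _),
      Real.log_exp, Real.log_exp]
    ring
  have h2 : 0 ≤ ∑ j, (Φp j * (Real.exp (dotv (ν j) q) - 1 - dotv (ν j) q)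
             + Φm j * (Real.exp (-(dotv (ν j) q)) - 1 + dotv (ν j) q)) := by
    refine Finset.sum_nonneg fun j _ => ?_
    have e1 := Real.add_one_le_exp (dotv (ν j) q)
    have e2 := Real.add_one_le_exp (-(dotv (ν j) q))
    exact add_nonneg (mul_nonneg (hΦp j).le (by linarith))
      (mul_nonneg (hΦm j).le (by linarith))
  have h3 : 0 ≤ ∑ j, (KLdiv (Φp j) (Φm j * Real.exp (-(dotv (ν j) q)))
             + KLdiv (Φm j) (Φp j * Real.exp (dotv (ν j) q))) :=
    Finset.sum_nonneg fun j _ => add_nonneg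
      (hKL _ _ (hΦp j) (mul_pos (hΦm j) (Real.exp_pos _)))
      (hKL _ _ (hΦm j) (mul_pos (hΦp j) (Real.exp_pos _)))
  exact ⟨h1, h2, h3, h1 ▸ add_nonneg h2 h3⟩
end

section
/- Let S be a finite set, Q : S × S → ℝ a generator matrix (Q(x,y) ≥ 0 for x ≠ y and Σ_{y∈S} Q(x,y) = 0 for every x), and π : S → (0,∞) an invariant measure (Σ_{y∈S} Q(y,x)π(y) = 0 for every x). Let p : [0,T] → (S → (0,∞)) be differentiable and solve the forward (master) equation d/dt p(x,t) = Σ_{y∈S} Q(y,x) p(y,t). Let φ : (0,∞) → ℝ be twice continuously differentiable and convex, and set D_φ(y,x) := φ(y) − φ(x) − (y − x)φ′(x) ≥ 0 (the Bregman divergence). Then for every t, d/dt Σ_{x∈S} φ(p(x,t)/π(x)) π(x) = − Σ_{x,y∈S} Q(y,x) π(y) D_φ(p(y,t)/π(y), p(x,t)/π(x)) ≤ 0. -/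
open scoped BigOperators

/-- φ-divergence energy dissipation law for a finite-state continuous-time
Markov chain.  For a generator matrix `Q` with invariant positive measure `π`, a positive
solution `p` of the master equation `d/dt p(x,t) = Σ_y Q(y,x) p(y,t)` on `[0,T]`, and a
`C²` convex function `φ` on `(0,∞)`, the free energy `F(p) = Σ_x φ(p(x)/π(x)) π(x)`
dissipates at the explicit rate `−Σ_{x,y} Q(y,x) π(y) D_φ(p(y)/π(y), p(x)/π(x)) ≤ 0`,
where `D_φ(y,x) = φ(y) − φ(x) − (y−x)φ'(x)` is the Bregman divergence. -/
theorem stmt11 {S : Type*} [Fintype S] (Q : S → S → ℝ)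
    (hQoff : ∀ x y : S, x ≠ y → 0 ≤ Q x y)
    (hQrow : ∀ x : S, ∑ y, Q x y = 0)
    (π : S → ℝ) (hπ : ∀ x, 0 < π x)
    (hinv : ∀ x : S, ∑ y, Q y x * π y = 0)
    (T : ℝ) (p : ℝ → S → ℝ)
    (hppos : ∀ t ∈ Set.Icc (0:ℝ) T, ∀ x, 0 < p t x)
    (hmaster : ∀ t ∈ Set.Icc (0:ℝ) T, ∀ x : S,
      HasDerivWithinAt (fun τ => p τ x) (∑ y, Q y x * p t y) (Set.Icc (0:ℝ) T) t)
    (φ : ℝ → ℝ) (hφ : ContDiffOn ℝ 2 φ (Set.Ioi 0))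
    (hφconv : ConvexOn ℝ (Set.Ioi 0) φ) :
    ∀ t ∈ Set.Icc (0:ℝ) T,
      HasDerivWithinAt (fun τ => ∑ x, φ (p τ x / π x) * π x)
        (-(∑ x, ∑ y, Q y x * π y *
            (φ (p t y / π y) - φ (p t x / π x)
              - (p t y / π y - p t x / π x) * deriv φ (p t x / π x))))
        (Set.Icc (0:ℝ) T) t ∧
      (-(∑ x, ∑ y, Q y x * π y *
          (φ (p t y / π y) - φ (p t x / π x)
            - (p t y / π y - p t x / π x) * deriv φ (p t x / π x)))) ≤ 0 := by
  intro t ht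
  have hu : ∀ x, 0 < p t x / π x := fun x => div_pos (hppos t ht x) (hπ x)
  have hd : ∀ v : ℝ, 0 < v → HasDerivAt φ (deriv φ v) v := fun v hv =>
    ((hφ.differentiableOn (by norm_num)).differentiableAt (Ioi_mem_nhds hv)).hasDerivAt
  have hB : ∀ a b : ℝ, 0 < a → 0 < b → 0 ≤ φ a - φ b - (a - b) * deriv φ b := by
    intro a b ha hb
    rcases lt_trichotomy a b with h | h | h
    · have := hφconv.slope_le_of_hasDerivAt (x := a) (y := b) ha hb h (hd b hb)
      rw [slope_def_field, div_le_iff₀ (by linarith)] at this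
      linarith
    · subst h; simp
    · have := hφconv.le_slope_of_hasDerivAt (x := b) (y := a) hb ha h (hd b hb)
      rw [slope_def_field, le_div_iff₀ (by linarith)] at this
      linarith
  constructor
  · have key : ∀ x ∈ (Finset.univ : Finset S),
        HasDerivWithinAt (fun τ => φ (p τ x / π x) * π x)
        (deriv φ (p t x / π x) * ((∑ y, Q y x * p t y) / π x) * π x) (Set.Icc (0:ℝ) T) t := by
      intro x _
      exact ((hd _ (hu x)).comp_hasDerivWithinAt (h := fun τ => p τ x / π x) t
        ((hmaster t ht x).div_const (π x))).mul_const (π x)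
    have h := HasDerivWithinAt.fun_sum key
    refine h.congr_deriv ?_
    have h1 : ∑ x, ∑ y, Q y x * π y * φ (p t y / π y) = 0 := by
      rw [Finset.sum_comm]
      refine Finset.sum_eq_zero fun y _ => ?_
      simp only [mul_assoc]
      rw [← Finset.sum_mul, hQrow, zero_mul]
    have h2 : ∀ x, ∑ y, Q y x * π y * (φ (p t y / π y) - φ (p t x / π x)
              - (p t y / π y - p t x / π x) * deriv φ (p t x / π x))
        = ∑ y, Q y x * π y * φ (p t y / π y)
          - deriv φ (p t x / π x) * ((∑ y, Q y x * p t y) / π x) * π x := by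
      intro x
      have e : ∀ y, Q y x * π y * (φ (p t y / π y) - φ (p t x / π x)
              - (p t y / π y - p t x / π x) * deriv φ (p t x / π x))
          = Q y x * π y * φ (p t y / π y)
            - (Q y x * p t y) * deriv φ (p t x / π x)
            - (Q y x * π y) * (φ (p t x / π x) - p t x / π x * deriv φ (p t x / π x)) := by
        intro y
        have : p t y = π y * (p t y / π y) := by
          have := (hπ y).ne'
          field_simp
        generalize p t y / π y = w at *
        rw [this]; ring
      simp only [e]
      rw [Finset.sum_sub_distrib, Finset.sum_sub_distrib, ← Finset.sum_mul, ← Finset.sum_mul,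
        hinv, zero_mul, sub_zero, mul_assoc (deriv φ _), div_mul_cancel₀ _ (hπ x).ne',
        mul_comm (deriv φ _)]
    simp only [h2]
    rw [Finset.sum_sub_distrib, h1]
    ring
  · rw [neg_nonpos]
    refine Finset.sum_nonneg fun x _ => Finset.sum_nonneg fun y _ => ?_
    by_cases h : y = x
    · subst h; simp
    · exact mul_nonneg (mul_nonneg (hQoff y x h) (hπ y).le) (hB _ _ (hu y) (hu x))
end

section
/- Let K ∈ ℕ and let ξ_1,…,ξ_K ∈ ℝ^N be vectors that are pairwise distinct, all nonzero, and satisfy ξ_k ≠ −ξ_l for all k, l. Let a_1,…,a_K ≥ 0 and b_1,…,b_K ≥ 0 be nonnegative reals (the grouped forward/backward fluxes Φ⁺_ξ, Φ⁻_ξ at a fixed state), let q ∈ ℝ^N, and define H(p) := Σ_{k=1}^K [a_k(e^{ξ_k·p} − 1) + b_k(e^{−ξ_k·p} − 1)]. Then the symmetry H(p) = H(q − p) holds for every p ∈ ℝ^N if and only if e^{ξ_k·q} a_k = b_k for every k = 1,…,K. -/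
open scoped BigOperators

theorem dotv_add_right {N : ℕ} (v x y : Fin N → ℝ) : dotv v (x + y) = dotv v x + dotv v y := by
  simp [dotv, mul_add, Finset.sum_add_distrib]

theorem dotv_sub_right {N : ℕ} (v x y : Fin N → ℝ) : dotv v (x - y) = dotv v x - dotv v y := by
  simp [dotv, mul_sub, Finset.sum_sub_distrib]

theorem dotv_neg_left {N : ℕ} (v x : Fin N → ℝ) : dotv (-v) x = - dotv v x := by
  simp [dotv]

/-- The character `p ↦ e^{v·p}`. -/
noncomputable def expChar {N : ℕ} (v : Fin N → ℝ) : Multiplicative (Fin N → ℝ) →* ℝ where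
  toFun p := Real.exp (dotv v p.toAdd)
  map_one' := by simp [dotv]
  map_mul' x y := by rw [toAdd_mul, dotv_add_right, Real.exp_add]

theorem expChar_injective {N : ℕ} : Function.Injective (expChar (N := N)) := by
  intro v w h
  funext i
  have h1 := DFunLike.congr_fun h (Multiplicative.ofAdd (Pi.single i (1 : ℝ)))
  simpa [expChar, dotv, Pi.single_apply] using h1

/-- for pairwise distinct nonzero reaction vectors `ξ_k` with
`ξ_k ≠ −ξ_l` for all `k,l`, nonnegative grouped fluxes `a_k, b_k`, and
`H(p) = Σ_k [a_k(e^{ξ_k·p} − 1) + b_k(e^{−ξ_k·p} − 1)]`, the symmetry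
`H(p) = H(q − p)` for all `p` holds iff `e^{ξ_k·q} a_k = b_k` for every `k`. -/
theorem stmt12 {N K : ℕ} (ξ : Fin K → Fin N → ℝ)
    (hdist : ∀ k l : Fin K, k ≠ l → ξ k ≠ ξ l)
    (hnz : ∀ k, ξ k ≠ 0)
    (hopp : ∀ k l : Fin K, ξ k ≠ -ξ l)
    (a b : Fin K → ℝ) (ha : ∀ k, 0 ≤ a k) (hb : ∀ k, 0 ≤ b k)
    (q : Fin N → ℝ) :
    (∀ p : Fin N → ℝ,
        (∑ k, (a k * (Real.exp (dotv (ξ k) p) - 1)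
             + b k * (Real.exp (-(dotv (ξ k) p)) - 1)))
      = (∑ k, (a k * (Real.exp (dotv (ξ k) (q - p)) - 1)
             + b k * (Real.exp (-(dotv (ξ k) (q - p))) - 1))))
    ↔ (∀ k, Real.exp (dotv (ξ k) q) * a k = b k) := by
  constructor
  · intro h
    have hinj : Function.Injective (Sum.elim ξ (fun k => -ξ k)) := by
      rintro (k | k) (l | l) hkl
      · by_contra hne
        exact hdist k l (fun e => hne (by rw [e])) hkl
      · exact absurd hkl (hopp k l)
      · exact absurd hkl.symm (hopp l k)
      · by_contra hne
        exact hdist k l (fun e => hne (by rw [e])) (neg_injective hkl)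
    have hli := (linearIndependent_monoidHom (Multiplicative (Fin N → ℝ)) ℝ).comp _
      (expChar_injective.comp hinj)
    rw [Fintype.linearIndependent_iff] at hli
    have h0 := hli (Sum.elim (fun k => a k - b k * Real.exp (-(dotv (ξ k) q)))
      (fun k => b k - a k * Real.exp (dotv (ξ k) q))) (by
        funext p
        have hp := h p.toAdd
        rw [← sub_eq_zero, ← Finset.sum_sub_distrib] at hp
        simp only [Fintype.sum_sum_type, Pi.add_apply, Finset.sum_apply, Pi.smul_apply,
          Function.comp_apply, Sum.elim_inl, Sum.elim_inr, smul_eq_mul, Pi.zero_apply]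
        rw [← Finset.sum_add_distrib, ← hp]
        refine Finset.sum_congr rfl fun k _ => ?_
        simp only [expChar, MonoidHom.coe_mk, OneHom.coe_mk, dotv_neg_left, dotv_sub_right]
        simp only [sub_eq_add_neg, Real.exp_add, neg_add, neg_neg]
        ring)
    intro k
    have := h0 (Sum.inr k)
    simp only [Sum.elim_inr] at this
    linarith
  · intro h p
    refine Finset.sum_congr rfl fun k _ => ?_
    rw [← h k, dotv_sub_right, neg_sub]
    have e1 : Real.exp (dotv (ξ k) q - dotv (ξ k) p)
        = Real.exp (dotv (ξ k) q) * Real.exp (-(dotv (ξ k) p)) := by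
      rw [← Real.exp_add, sub_eq_add_neg]
    have e2 : Real.exp (dotv (ξ k) p)
        = Real.exp (dotv (ξ k) q) * Real.exp (dotv (ξ k) p - dotv (ξ k) q) := by
      rw [← Real.exp_add]; ring_nf
    rw [e1, e2]
    ring
end

section
/- Let K ∈ ℕ, ξ_1,…,ξ_K ∈ ℝ^N, a_1,…,a_K ≥ 0 and b_1,…,b_K ≥ 0 nonnegative reals, and q ∈ ℝ^N. Assume: (i) the steady-state condition Σ_{k=1}^K ξ_k (a_k − b_k) = 0; (ii) the flux symmetry relation e^{ξ_k·q} a_k = b_k for every k. Then a_k = b_k for every k = 1,…,K. In the chemical reaction setting this says: if the Hamiltonian is symmetric with respect to ∇ψ^{ss} and x^s is a steady state of the reaction rate equation, then each grouped forward flux balances its grouped backward flux at x^s: Φ⁺_ξ(x^s) = Φ⁻_ξ(x^s) for every reaction vector ξ. -/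
open scoped BigOperators

/-- if the grouped fluxes `a_k, b_k ≥ 0` satisfy the steady-state
condition `Σ_k (a_k − b_k) ξ_k = 0` and the flux symmetry relation
`e^{ξ_k·q} a_k = b_k` for every `k`, then each grouped forward flux balances its
grouped backward flux: `a_k = b_k` for all `k`. -/
theorem stmt13 {N K : ℕ} (ξ : Fin K → Fin N → ℝ)
    (a b : Fin K → ℝ) (ha : ∀ k, 0 ≤ a k) (hb : ∀ k, 0 ≤ b k)
    (q : Fin N → ℝ)
    (hsteady : ∀ i : Fin N, (∑ k, (a k - b k) * ξ k i) = 0)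
    (hsym : ∀ k, Real.exp (dotv (ξ k) q) * a k = b k) :
    ∀ k, a k = b k := by
  have h0 : ∑ k, (b k - a k) * dotv (ξ k) q = 0 := by
    have h1 : ∑ k, (b k - a k) * dotv (ξ k) q
        = ∑ i, -(∑ k, (a k - b k) * ξ k i) * q i := by
      simp only [dotv, Finset.mul_sum, ← Finset.sum_neg_distrib, Finset.sum_mul]
      rw [Finset.sum_comm]
      refine Finset.sum_congr rfl fun i _ => Finset.sum_congr rfl fun k _ => ?_
      ring
    rw [h1]
    simp [hsteady]
  have hnn : ∀ k ∈ Finset.univ, 0 ≤ (b k - a k) * dotv (ξ k) q := by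
    intro k _
    rw [← hsym k]
    have e : (Real.exp (dotv (ξ k) q) * a k - a k) * dotv (ξ k) q
        = a k * ((Real.exp (dotv (ξ k) q) - 1) * dotv (ξ k) q) := by ring
    rw [e]
    refine mul_nonneg (ha k) ?_
    rcases le_total 0 (dotv (ξ k) q) with h | h
    · exact mul_nonneg (sub_nonneg.2 (Real.one_le_exp h)) h
    · exact mul_nonneg_of_nonpos_of_nonpos (sub_nonpos.2 (Real.exp_le_one_iff.2 h)) h
  intro k
  have hk := (Finset.sum_eq_zero_iff_of_nonneg hnn).1 h0 k (Finset.mem_univ k)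
  rcases mul_eq_zero.1 hk with h | h
  · linarith
  · have := hsym k
    rw [h, Real.exp_zero, one_mul] at this
    exact this
end

section
/- Let U ⊆ ℝ^N be open, H : ℝ^N × U → ℝ with p ↦ H(p,x) twice continuously differentiable for each x ∈ U, and let ψ : U → ℝ be differentiable such that the symmetry H(p,x) = H(∇ψ(x) − p, x) holds for all p ∈ ℝ^N and x ∈ U. Then for every x ∈ U: (a) ∫₀¹ ∇_p H(θ∇ψ(x), x) dθ = 0; (b) consequently ∇_p H(0,x) = − K(x) ∇ψ(x), where K(x) := ∫₀¹ (1−θ) ∇²_{pp} H(θ∇ψ(x), x) dθ; (c) moreover K(x) = (1/2) ∫₀¹ ∇²_{pp} H(θ∇ψ(x), x) dθ. In other words, under the symmetry the dynamics ẋ = ∇_p H(0,x) is an Onsager-type strong gradient flow of ψ. -/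
open scoped BigOperators

/-- under the symmetry `H(p,x) = H(∇ψ(x) − p, x)`, with `H(·,x)` of class
`C²` and `Hp`, `Hpp` its gradient and Hessian in `p`: (a) `∫₀¹ ∇_p H(θ∇ψ(x),x) dθ = 0`;
(b) `∇_p H(0,x) = −K(x)∇ψ(x)` where `K(x) = ∫₀¹ (1−θ)∇²_{pp}H(θ∇ψ(x),x) dθ`; and
(c) `K(x) = ½ ∫₀¹ ∇²_{pp}H(θ∇ψ(x),x) dθ`.  Hence `ẋ = ∇_p H(0,x)` is an Onsager-type
strong gradient flow of `ψ`. -/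
theorem stmt14 {N : ℕ} (U : Set (Fin N → ℝ)) (hU : IsOpen U)
    (H : (Fin N → ℝ) → (Fin N → ℝ) → ℝ)
    (Hp : (Fin N → ℝ) → (Fin N → ℝ) → (Fin N → ℝ))
    (Hpp : (Fin N → ℝ) → (Fin N → ℝ) → Matrix (Fin N) (Fin N) ℝ)
    (hC2 : ∀ x ∈ U, ContDiff ℝ 2 (fun p => H p x))
    (hHp : ∀ x ∈ U, ∀ p v : Fin N → ℝ,
      HasDerivAt (fun t : ℝ => H (p + t • v) x) (dotv (Hp p x) v) 0)
    (hHpp : ∀ x ∈ U, ∀ p v w : Fin N → ℝ,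
      HasDerivAt (fun t : ℝ => dotv (Hp (p + t • w) x) v)
        (∑ i, ∑ k, v i * Hpp p x i k * w k) 0)
    (ψ : (Fin N → ℝ) → ℝ) (gψ : (Fin N → ℝ) → (Fin N → ℝ))
    (hgψ : ∀ x ∈ U, HasFDerivAt ψ (dotCLM (gψ x)) x)
    (hsym : ∀ x ∈ U, ∀ p : Fin N → ℝ, H p x = H (gψ x - p) x) :
    ∀ x ∈ U,
      (∀ i, (∫ θ in (0:ℝ)..1, Hp (θ • gψ x) x i) = 0) ∧
      (∀ i, Hp 0 x i
        = -(∑ k, (∫ θ in (0:ℝ)..1, (1 - θ) * Hpp (θ • gψ x) x i k) * gψ x k)) ∧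
      (∀ i k, (∫ θ in (0:ℝ)..1, (1 - θ) * Hpp (θ • gψ x) x i k)
        = (1 / 2) * ∫ θ in (0:ℝ)..1, Hpp (θ • gψ x) x i k) := by
  intro x hx
  set g := gψ x with hg
  have hline : ∀ p w : Fin N → ℝ, HasDerivAt (fun t : ℝ => p + t • w) w 0 := by
    intro p w
    simpa using ((hasDerivAt_id (0:ℝ)).smul_const w).const_add p
  have hF : ContDiff ℝ 2 (fun p => H p x) := hC2 x hx
  have hG : ∀ p i, Hp p x i = fderiv ℝ (fun p => H p x) p (Pi.single i 1) := by
    intro p i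
    have h1 := hHp x hx p (Pi.single i 1)
    have hd : HasFDerivAt (fun p => H p x) (fderiv ℝ (fun p => H p x) p)
        (p + (0:ℝ) • (Pi.single i 1 : Fin N → ℝ)) := by
      simpa using ((hF.differentiable (by norm_num)) p).hasFDerivAt
    have h2 := hd.comp_hasDerivAt (0:ℝ) (hline p (Pi.single i 1))
    have h3 := h1.unique h2
    rw [← h3]
    simp [dotv, Pi.single_apply]
  have hGC : ∀ i, ContDiff ℝ 1 (fun p => Hp p x i) := by
    intro i
    have : (fun p => Hp p x i) = fun p => fderiv ℝ (fun p => H p x) p (Pi.single i 1) :=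
      funext fun p => hG p i
    rw [this]
    exact (hF.fderiv_right (m := 1) (by norm_num)).clm_apply contDiff_const
  have hGd : ∀ i p, HasFDerivAt (fun p => Hp p x i) (fderiv ℝ (fun p => Hp p x i) p) p :=
    fun i p => (((hGC i).differentiable (by norm_num)) p).hasFDerivAt
  have hW : ∀ i p w, fderiv ℝ (fun p => Hp p x i) p w = ∑ k, Hpp p x i k * w k := by
    intro i p w
    have h1 := hHpp x hx p (Pi.single i 1) w
    have hd : HasFDerivAt (fun p => Hp p x i) (fderiv ℝ (fun p => Hp p x i) p)
        (p + (0:ℝ) • w) := by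
      simpa using hGd i p
    have h2 := hd.comp_hasDerivAt (0:ℝ) (hline p w)
    have h4 : (fun t : ℝ => dotv (Hp (p + t • w) x) (Pi.single i 1))
        = (fun p => Hp p x i) ∘ (fun t : ℝ => p + t • w) := by
      funext t
      simp [dotv, Pi.single_apply]
    rw [h4] at h1
    rw [h2.unique h1, Finset.sum_eq_single i]
    · simp
    · intro b _ hb
      simp [Pi.single_apply, hb]
    · simp
  have hK : ∀ i k p, Hpp p x i k = fderiv ℝ (fun p => Hp p x i) p (Pi.single k 1) := by
    intro i k p
    rw [hW]
    simp [Pi.single_apply]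
  have hKc : ∀ i k, Continuous (fun p => Hpp p x i k) := by
    intro i k
    have : (fun p => Hpp p x i k) =
        fun p => fderiv ℝ (fun p => Hp p x i) p (Pi.single k 1) := funext fun p => hK i k p
    rw [this]
    exact ((hGC i).continuous_fderiv (by norm_num)).clm_apply continuous_const
  have hsub : ∀ p : Fin N → ℝ, HasFDerivAt (fun p : Fin N → ℝ => g - p)
      (-(ContinuousLinearMap.id ℝ (Fin N → ℝ))) p := fun p => (hasFDerivAt_id p).const_sub g
  have hanti : ∀ i p, Hp (g - p) x i = - Hp p x i := by
    intro i p
    have h1 := (((hF.differentiable (by norm_num)) (g - p)).hasFDerivAt).comp p (hsub p)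
    have h2 : (fun p => H p x) ∘ (fun p => g - p) = fun p => H p x :=
      funext fun q => (hsym x hx q).symm
    rw [h2] at h1
    rw [hG, hG p, h1.fderiv]
    simp
  have hsymK : ∀ i k p, Hpp (g - p) x i k = Hpp p x i k := by
    intro i k p
    have h1 := (hGd i (g - p)).comp p (hsub p)
    have h2 : (fun p => Hp p x i) ∘ (fun p => g - p) = fun p => - Hp p x i :=
      funext fun q => hanti i q
    rw [h2] at h1
    have h3 := h1.unique (hGd i p).neg
    have h4 := congrArg (fun L => L (Pi.single k 1)) h3
    rw [hK, hK i k p]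
    simpa using h4
  have hθ : ∀ θ : ℝ, (1 - θ) • g = g - θ • g := fun θ => by rw [sub_smul, one_smul]
  have hsc : Continuous (fun θ : ℝ => θ • g) := by fun_prop
  have hGi : ∀ i, Continuous (fun θ : ℝ => Hp (θ • g) x i) :=
    fun i => (hGC i).continuous.comp hsc
  have hKi : ∀ i k, Continuous (fun θ : ℝ => Hpp (θ • g) x i k) :=
    fun i k => (hKc i k).comp hsc
  have hKi' : ∀ i k, Continuous (fun θ : ℝ => (1 - θ) * Hpp (θ • g) x i k) :=
    fun i k => (continuous_const.sub continuous_id).mul (hKi i k)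
  have ha : ∀ i, (∫ θ in (0:ℝ)..1, Hp (θ • g) x i) = 0 := by
    intro i
    have h1 := intervalIntegral.integral_comp_sub_left (a := 0) (b := 1)
      (fun θ : ℝ => Hp (θ • g) x i) 1
    simp only [hθ, hanti, intervalIntegral.integral_neg, sub_self, sub_zero] at h1
    linarith
  refine ⟨ha, ?_, ?_⟩
  · intro i
    have hder : ∀ θ : ℝ, HasDerivAt (fun θ : ℝ => (1 - θ) * Hp (θ • g) x i)
        (-Hp (θ • g) x i + ∑ k, (1 - θ) * Hpp (θ • g) x i k * g k) θ := by
      intro θ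
      have h1 : HasDerivAt (fun θ : ℝ => θ • g) g θ := by
        simpa using (hasDerivAt_id θ).smul_const g
      have h2 : HasDerivAt (fun θ : ℝ => Hp (θ • g) x i)
          (fderiv ℝ (fun p => Hp p x i) (θ • g) g) θ := by
        have h5 := HasFDerivAt.comp_hasDerivAt (l := fun p => Hp p x i)
          (f := fun θ : ℝ => θ • g) θ (hGd i (θ • g)) h1
        exact h5
      have h3 := ((hasDerivAt_id θ).const_sub 1).mul h2
      refine h3.congr_deriv ?_
      rw [hW, Finset.mul_sum]
      simp [mul_assoc]
    have hn : Continuous (fun θ : ℝ => - Hp (θ • g) x i) := (hGi i).neg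
    have ht : ∀ k, Continuous (fun θ : ℝ => (1 - θ) * Hpp (θ • g) x i k * g k) :=
      fun k => (hKi' i k).mul continuous_const
    have hc : Continuous (fun θ : ℝ => ∑ k, (1 - θ) * Hpp (θ • g) x i k * g k) :=
      continuous_finsetSum _ fun k _ => ht k
    have h1 := intervalIntegral.integral_eq_sub_of_hasDerivAt (a := 0) (b := 1)
      (fun θ _ => hder θ) ((hn.add hc).intervalIntegrable _ _)
    rw [intervalIntegral.integral_add (hn.intervalIntegrable _ _)
      (hc.intervalIntegrable _ _), intervalIntegral.integral_neg, ha,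
      intervalIntegral.integral_finsetSum
        (fun k _ => (ht k).intervalIntegrable _ _)] at h1
    simp only [intervalIntegral.integral_mul_const] at h1
    rw [neg_zero, zero_add] at h1
    rw [h1]
    simp
  · intro i k
    have h1 := intervalIntegral.integral_comp_sub_left (a := 0) (b := 1)
      (fun θ : ℝ => (1 - θ) * Hpp (θ • g) x i k) 1
    simp only [hθ, hsymK, sub_self, sub_zero, sub_sub_cancel] at h1
    have hm : Continuous (fun θ : ℝ => θ * Hpp (θ • g) x i k) := continuous_id.mul (hKi i k)
    have h2 : (∫ θ in (0:ℝ)..1, θ * Hpp (θ • g) x i k)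
        + (∫ θ in (0:ℝ)..1, (1 - θ) * Hpp (θ • g) x i k)
        = ∫ θ in (0:ℝ)..1, Hpp (θ • g) x i k := by
      rw [← intervalIntegral.integral_add
        (hm.intervalIntegrable _ _)
        ((hKi' i k).intervalIntegrable _ _)]
      congr 1
      funext θ
      ring
    linarith
end

section
/- Assume k⁺_j > 0 and k⁻_j > 0 for every j, and let x^s ∈ ℝ^N have all components strictly positive and satisfy detailed balance. Then for every x ∈ ℝ^N with all components strictly positive, R(x) = − K(x) ∇ψ(x), where ψ(x) := Σ_{i=1}^N (x_i log(x_i/x^s_i) − x_i + x^s_i) (so ∇ψ(x) has components log(x_i/x^s_i)), and K(x) := Σ_{j=1}^M Λ(Φ⁺_j(x), Φ⁻_j(x)) ν_j ⊗ ν_j, with Λ(a,b) := (a − b)/(log a − log b) for a ≠ b and Λ(a,a) := a the logarithmic mean. In particular, the reaction rate equation is a strong gradient flow of the relative entropy with the logarithmic-mean Onsager matrix. -/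
open scoped BigOperators

/-- The logarithmic mean `Λ(a,b) = (a − b)/(log a − log b)` for `a ≠ b`, `Λ(a,a) = a`. -/
noncomputable def logMean (a b : ℝ) : ℝ :=
  if a = b then a else (a - b) / (Real.log a - Real.log b)

theorem log_flux_aux {N M : ℕ} (ν : Fin M → Fin N → ℕ) (k : Fin M → ℝ)
    (hk : ∀ j, 0 < k j) (x : Fin N → ℝ) (hx : ∀ i, 0 < x i) (j : Fin M) :
    Real.log (k j * ∏ i, x i ^ (ν j i))
      = Real.log (k j) + ∑ i, (ν j i : ℝ) * Real.log (x i) := by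
  have h : ∀ i ∈ Finset.univ, x i ^ (ν j i) ≠ 0 := fun i _ => (pow_pos (hx i) _).ne'
  rw [Real.log_mul (hk j).ne' (Finset.prod_ne_zero_iff.mpr h), Real.log_prod h]
  simp [Real.log_pow]

theorem logMean_mul_aux (a b : ℝ) (ha : 0 < a) (hb : 0 < b) :
    logMean a b * (Real.log a - Real.log b) = a - b := by
  unfold logMean
  split_ifs with h
  · simp [h]
  · apply div_mul_cancel₀
    intro h0
    exact h (Real.log_injOn_pos ha hb (sub_eq_zero.mp h0))

/-- under reversibility and detailed balance at a positive state `xs`,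
the reaction rate equation is the strong gradient flow `R(x) = −K(x)∇ψ(x)` of the
relative entropy `ψ(x) = Σ_i (x_i log(x_i/xs_i) − x_i + xs_i)` (so `∇ψ(x)_i =
log(x_i/xs_i)`), with Onsager matrix `K(x) = Σ_j Λ(Φ⁺_j(x),Φ⁻_j(x)) ν_j ⊗ ν_j`. -/
theorem stmt15 {N M : ℕ} (νp νm : Fin M → Fin N → ℕ) (kp km : Fin M → ℝ)
    (hkp : ∀ j, 0 < kp j) (hkm : ∀ j, 0 < km j)
    (xs : Fin N → ℝ) (hxs : ∀ i, 0 < xs i)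
    (hdb : ∀ j, PhiP νp kp xs j = PhiM νm km xs j) :
    ∀ x : Fin N → ℝ, (∀ i, 0 < x i) → ∀ i : Fin N,
      RRE νp νm kp km x i =
        -(∑ k, (∑ j, logMean (PhiP νp kp x j) (PhiM νm km x j)
                  * nuv νp νm j i * nuv νp νm j k)
            * Real.log (x k / xs k)) := by
  intro x hx i
  have key : ∀ j, ∑ k, nuv νp νm j k * Real.log (x k / xs k)
      = -(Real.log (PhiP νp kp x j) - Real.log (PhiM νm km x j)) := by
    intro j
    have h0 := congrArg Real.log (hdb j)
    unfold PhiP PhiM at *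
    rw [log_flux_aux νp kp hkp xs hxs, log_flux_aux νm km hkm xs hxs] at h0
    rw [log_flux_aux νp kp hkp x hx, log_flux_aux νm km hkm x hx]
    have e : ∀ k, nuv νp νm j k * Real.log (x k / xs k)
        = (νm j k : ℝ) * Real.log (x k) - (νp j k : ℝ) * Real.log (x k)
          - ((νm j k : ℝ) * Real.log (xs k) - (νp j k : ℝ) * Real.log (xs k)) := by
      intro k
      rw [Real.log_div (hx k).ne' (hxs k).ne']
      unfold nuv
      ring
    simp only [e, Finset.sum_sub_distrib]
    linarith
  have hP : ∀ j, 0 < PhiP νp kp x j := fun j =>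
    mul_pos (hkp j) (Finset.prod_pos fun i _ => pow_pos (hx i) _)
  have hM : ∀ j, 0 < PhiM νm km x j := fun j =>
    mul_pos (hkm j) (Finset.prod_pos fun i _ => pow_pos (hx i) _)
  simp only [Finset.sum_mul]
  rw [Finset.sum_comm, ← Finset.sum_neg_distrib]
  unfold RRE
  refine Finset.sum_congr rfl fun j _ => ?_
  simp only [mul_assoc]
  rw [← Finset.mul_sum, ← Finset.mul_sum, key, ← logMean_mul_aux _ _ (hP j) (hM j)]
  ring
end

section
/- Assume k⁺_j > 0 and k⁻_j > 0 for every j, and let x^s ∈ ℝ^N have all components strictly positive and satisfy detailed balance. Then the Hamiltonian is symmetric with respect to the relative-entropy gradient: for every x ∈ ℝ^N with all components strictly positive and every p ∈ ℝ^N, H(p, x) = H(log(x/x^s) − p, x), where log(x/x^s) denotes the vector with components log(x_i/x^s_i). -/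
open scoped BigOperators

theorem aux_exp_form {N : ℕ} (n : Fin N → ℕ) (k : ℝ) (hk : 0 < k) (x : Fin N → ℝ)
    (hx : ∀ i, 0 < x i) :
    k * ∏ i, x i ^ n i = Real.exp (Real.log k + ∑ i, (n i : ℝ) * Real.log (x i)) := by
  rw [Real.exp_add, Real.exp_log hk, Real.exp_sum]
  congr 1
  refine Finset.prod_congr rfl fun i _ => ?_
  rw [Real.exp_nat_mul, Real.exp_log (hx i)]

/-- under reversibility and detailed balance at a positive state `xs`,
the Hamiltonian is symmetric with respect to the relative-entropy gradient:
`H(p,x) = H(log(x/xs) − p, x)` for all positive `x` and all `p`. -/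
theorem stmt16 {N M : ℕ} (νp νm : Fin M → Fin N → ℕ) (kp km : Fin M → ℝ)
    (hkp : ∀ j, 0 < kp j) (hkm : ∀ j, 0 < km j)
    (xs : Fin N → ℝ) (hxs : ∀ i, 0 < xs i)
    (hdb : ∀ j, PhiP νp kp xs j = PhiM νm km xs j) :
    ∀ x : Fin N → ℝ, (∀ i, 0 < x i) → ∀ p : Fin N → ℝ,
      Ham νp νm kp km p x
        = Ham νp νm kp km (fun i => Real.log (x i / xs i) - p i) x := by
  intro x hx p
  unfold Ham
  refine Finset.sum_congr rfl fun j _ => ?_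
  have hd := hdb j
  unfold PhiP PhiM at *
  rw [aux_exp_form _ _ (hkp j) _ hxs, aux_exp_form _ _ (hkm j) _ hxs] at hd
  have hd := Real.exp_injective hd
  rw [aux_exp_form _ _ (hkp j) _ hx, aux_exp_form _ _ (hkm j) _ hx]
  have hs : dotv (nuv νp νm j) (fun i => Real.log (x i / xs i) - p i)
      = (Real.log (km j) + ∑ i, (νm j i : ℝ) * Real.log (x i))
        - (Real.log (kp j) + ∑ i, (νp j i : ℝ) * Real.log (x i))
        - dotv (nuv νp νm j) p := by
    have h1 : dotv (nuv νp νm j) (fun i => Real.log (x i / xs i) - p i)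
        = ∑ i, (νm j i : ℝ) * Real.log (x i) - ∑ i, (νp j i : ℝ) * Real.log (x i)
          - ∑ i, (νm j i : ℝ) * Real.log (xs i) + ∑ i, (νp j i : ℝ) * Real.log (xs i)
          - dotv (nuv νp νm j) p := by
      unfold dotv nuv
      simp only [← Finset.sum_sub_distrib, ← Finset.sum_add_distrib]
      refine Finset.sum_congr rfl fun i _ => ?_
      rw [Real.log_div (hx i).ne' (hxs i).ne']
      ring
    linarith
  rw [hs]
  simp only [mul_sub, ← Real.exp_add, mul_one]
  ring_nf
end

section
/- Let H : ℝ^N × ℝ^N → ℝ and q : ℝ^N → ℝ^N satisfy the symmetry H(p,x) = H(q(x) − p, x) for all p, x ∈ ℝ^N. Define the Lagrangian L(s,x) := sup_{p ∈ ℝ^N} (p·s − H(p,x)), with values in ℝ ∪ {+∞}. Then for every s, x ∈ ℝ^N, L(s,x) = L(−s,x) + s·q(x) (as an identity in ℝ ∪ {+∞}, where adding the real number s·q(x) to +∞ gives +∞); in particular L(s,x) is finite if and only if L(−s,x) is finite, and in that case L(s,x) − L(−s,x) = s·q(x), i.e. the forward and time-reversed Lagrangians differ by a null Lagrangian. -/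
open scoped BigOperators

/-- The Lagrangian `L(s,x) = sup_p (p·s − H(p,x))` with values in `ℝ ∪ {+∞} ⊆ EReal`. -/
noncomputable def LagOf {N : ℕ} (H : (Fin N → ℝ) → (Fin N → ℝ) → ℝ)
    (s x : Fin N → ℝ) : EReal :=
  ⨆ p : Fin N → ℝ, ((dotv p s - H p x : ℝ) : EReal)

theorem lag_le_aux {N : ℕ} (H : (Fin N → ℝ) → (Fin N → ℝ) → ℝ)
    (q : (Fin N → ℝ) → (Fin N → ℝ))
    (hsym : ∀ p x : Fin N → ℝ, H p x = H (q x - p) x) (s x : Fin N → ℝ) :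
    LagOf H s x ≤ LagOf H (-s) x + ((dotv s (q x) : ℝ) : EReal) := by
  unfold LagOf
  refine iSup_le fun p => ?_
  have h1 : dotv p s - H p x = (dotv (q x - p) (-s) - H (q x - p) x) + dotv s (q x) := by
    have h2 : dotv p s = dotv (q x - p) (-s) + dotv s (q x) := by
      unfold dotv
      rw [← Finset.sum_add_distrib]
      refine Finset.sum_congr rfl fun i _ => ?_
      simp only [Pi.sub_apply, Pi.neg_apply]
      ring
    rw [← hsym p x, h2]
    ring
  rw [h1, EReal.coe_add]
  gcongr
  exact le_iSup (fun p : Fin N → ℝ => ((dotv p (-s) - H p x : ℝ) : EReal)) (q x - p)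

/-- if `H(p,x) = H(q(x) − p, x)` for all `p,x`, then the Legendre transform
`L(s,x) = sup_p(p·s − H(p,x))` satisfies the time-reversal identity
`L(s,x) = L(−s,x) + s·q(x)` in `ℝ ∪ {+∞}`: the forward and time-reversed Lagrangians
differ by the null Lagrangian `s·q(x)`. -/
theorem stmt17 {N : ℕ} (H : (Fin N → ℝ) → (Fin N → ℝ) → ℝ)
    (q : (Fin N → ℝ) → (Fin N → ℝ))
    (hsym : ∀ p x : Fin N → ℝ, H p x = H (q x - p) x) :
    ∀ s x : Fin N → ℝ,
      LagOf H s x = LagOf H (-s) x + ((dotv s (q x) : ℝ) : EReal) := by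
  intro s x
  refine le_antisymm (lag_le_aux H q hsym s x) ?_
  have h := lag_le_aux H q hsym (-s) x
  rw [neg_neg] at h
  have hd : dotv (-s) (q x) = - dotv s (q x) := by
    simp [dotv]
  rw [hd] at h
  calc LagOf H (-s) x + ((dotv s (q x) : ℝ) : EReal)
      ≤ (LagOf H s x + ((- dotv s (q x) : ℝ) : EReal)) + ((dotv s (q x) : ℝ) : EReal) := by
        gcongr
    _ = LagOf H s x := by
        rw [add_assoc, ← EReal.coe_add]
        simp
end

section
/- Let H : ℝ^N × ℝ^N → ℝ be continuously differentiable and ψ : ℝ^N → ℝ be twice continuously differentiable, with the symmetry H(p,x) = H(∇ψ(x) − p, x) for all p, x ∈ ℝ^N. Let (x(t), p(t)), t ∈ [0,T], be a C¹ solution of the Hamiltonian system ẋ = ∇_p H(p,x), ṗ = −∇_x H(p,x). Define the time-reversed curve x^R(t) := x(T − t) and the modified reversed momentum p^{mR}(t) := ∇ψ(x^R(t)) − p(T − t). Then (x^R(t), p^{mR}(t)) solves the same Hamiltonian system: d/dt x^R = ∇_p H(p^{mR}, x^R) and d/dt p^{mR} = −∇_x H(p^{mR}, x^R) on [0,T].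 -/
open scoped BigOperators

lemma dotv_sub_left' {N : ℕ} {a b : Fin N → ℝ} (h : ∀ v, dotv a v = dotv b v) : a = b := by
  funext i
  have := h (Pi.single i 1)
  simpa [dotv, Pi.single_apply] using this

lemma dotCLM_apply' {N : ℕ} (a v : Fin N → ℝ) : dotCLM a v = dotv a v := by
  simp [dotCLM, dotv]

lemma clm_dotv {N : ℕ} (L : (Fin N → ℝ) →L[ℝ] ℝ) (v : Fin N → ℝ) :
    dotv (fun i => L (Pi.single i 1)) v = L v := by
  conv_rhs => rw [← Finset.univ_sum_single v, map_sum]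
  unfold dotv
  refine Finset.sum_congr rfl fun i _ => ?_
  have : (Pi.single i (v i) : Fin N → ℝ) = v i • Pi.single i 1 := by
    rw [← Pi.single_smul]; simp
  rw [this, map_smul, smul_eq_mul, mul_comm]

lemma grad_deriv {N : ℕ} (ψ : (Fin N → ℝ) → ℝ) (gψ : (Fin N → ℝ) → (Fin N → ℝ))
    (hψ : ContDiff ℝ 2 ψ)
    (hgψ : ∀ x : Fin N → ℝ, HasFDerivAt ψ (dotCLM (gψ x)) x) (x : Fin N → ℝ) :
    ∃ A : (Fin N → ℝ) →L[ℝ] (Fin N → ℝ), HasFDerivAt gψ A x ∧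
      ∀ u v, dotv (A u) v = dotv (A v) u := by
  have hd : DifferentiableAt ℝ (fderiv ℝ ψ) x :=
    ((hψ.fderiv_right (m := 1) (by norm_num)).differentiable (by norm_num)) x
  have hB := hd.hasFDerivAt
  set B := fderiv ℝ (fderiv ℝ ψ) x with hBdef
  have hs : ∀ u v, B u v = B v u := fun u v =>
    second_derivative_symmetric (f := ψ) (fun y => (hgψ y).differentiableAt.hasFDerivAt) hB u v
  refine ⟨ContinuousLinearMap.pi fun i => B.flip (Pi.single i 1), ?_, ?_⟩
  · rw [hasFDerivAt_pi']
    intro i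
    have h1 : HasFDerivAt (fun y => fderiv ℝ ψ y (Pi.single i 1)) (B.flip (Pi.single i 1)) x := by
      have := hB.clm_apply (hasFDerivAt_const (Pi.single i (1:ℝ) : Fin N → ℝ) x)
      simpa using this
    have h2 : (fun y => fderiv ℝ ψ y (Pi.single i 1)) = fun y => gψ y i := by
      funext y
      rw [(hgψ y).fderiv, dotCLM_apply']
      simp [dotv, Pi.single_apply]
    rw [h2] at h1
    exact h1
  · intro u v
    have h : ∀ u v, dotv ((ContinuousLinearMap.pi fun i => B.flip (Pi.single i 1)) u) v = B u v :=
      fun u v => clm_dotv (B u) v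
    rw [h, h, hs]

/-- time reversal of the Hamiltonian flow.  Let `H` be `C¹` with partial
gradients `Hp` (in `p`) and `Hx` (in `x`), let `ψ` be `C²` with gradient `gψ`, and assume
the symmetry `H(p,x) = H(∇ψ(x) − p, x)`.  If `(x(t), p(t))` solves `ẋ = ∇_p H(p,x)`,
`ṗ = −∇_x H(p,x)` on `[0,T]`, then the time-reversed curve `x^R(t) = x(T−t)` with the
modified reversed momentum `p^{mR}(t) = ∇ψ(x^R(t)) − p(T−t)` solves the same Hamiltonian
system. -/
theorem stmt18 {N : ℕ}
    (H : (Fin N → ℝ) → (Fin N → ℝ) → ℝ)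
    (Hp Hx : (Fin N → ℝ) → (Fin N → ℝ) → (Fin N → ℝ))
    (hC1 : ContDiff ℝ 1 (fun pq : (Fin N → ℝ) × (Fin N → ℝ) => H pq.1 pq.2))
    (hHp : ∀ p x v : Fin N → ℝ,
      HasDerivAt (fun t : ℝ => H (p + t • v) x) (dotv (Hp p x) v) 0)
    (hHx : ∀ p x v : Fin N → ℝ,
      HasDerivAt (fun t : ℝ => H p (x + t • v)) (dotv (Hx p x) v) 0)
    (ψ : (Fin N → ℝ) → ℝ) (gψ : (Fin N → ℝ) → (Fin N → ℝ))
    (hψ : ContDiff ℝ 2 ψ)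
    (hgψ : ∀ x : Fin N → ℝ, HasFDerivAt ψ (dotCLM (gψ x)) x)
    (hsym : ∀ p x : Fin N → ℝ, H p x = H (gψ x - p) x)
    (T : ℝ) (x p : ℝ → Fin N → ℝ)
    (hxode : ∀ t ∈ Set.Icc (0:ℝ) T,
      HasDerivWithinAt x (Hp (p t) (x t)) (Set.Icc (0:ℝ) T) t)
    (hpode : ∀ t ∈ Set.Icc (0:ℝ) T,
      HasDerivWithinAt p (-(Hx (p t) (x t))) (Set.Icc (0:ℝ) T) t) :
    ∀ t ∈ Set.Icc (0:ℝ) T,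
      HasDerivWithinAt (fun τ => x (T - τ))
        (Hp (gψ (x (T - t)) - p (T - t)) (x (T - t))) (Set.Icc (0:ℝ) T) t ∧
      HasDerivWithinAt (fun τ => gψ (x (T - τ)) - p (T - τ))
        (-(Hx (gψ (x (T - t)) - p (T - t)) (x (T - t)))) (Set.Icc (0:ℝ) T) t := by
  have hline : ∀ y v : Fin N → ℝ, HasDerivAt (fun t : ℝ => y + t • v) v 0 := by
    intro y v
    simpa using ((hasDerivAt_id (0:ℝ)).smul_const v).const_add y
  have hD : ∀ z, HasFDerivAt (fun pq : (Fin N → ℝ) × (Fin N → ℝ) => H pq.1 pq.2)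
      (fderiv ℝ (fun pq : (Fin N → ℝ) × (Fin N → ℝ) => H pq.1 pq.2) z) z := fun z =>
    ((hC1.differentiable (by norm_num)) z).hasFDerivAt
  set F := fderiv ℝ (fun pq : (Fin N → ℝ) × (Fin N → ℝ) => H pq.1 pq.2) with hF
  have hcomp : ∀ (a b : ℝ → Fin N → ℝ) (a' b' p x : Fin N → ℝ), a 0 = p → b 0 = x →
      HasDerivAt a a' 0 → HasDerivAt b b' 0 →
      HasDerivAt (fun t => H (a t) (b t)) (F (p, x) (a', b')) 0 := by
    rintro a b a' b' p x rfl rfl ha hb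
    exact (hD (a 0, b 0)).comp_hasDerivAt (0:ℝ) (ha.prodMk hb)
  have hFp : ∀ p x v, F (p, x) (v, 0) = dotv (Hp p x) v := fun p x v =>
    (hcomp (fun t => p + t • v) (fun _ => x) v 0 p x (by simp) rfl (hline p v)
      (hasDerivAt_const _ _)).unique (hHp p x v)
  have hFx : ∀ p x v, F (p, x) (0, v) = dotv (Hx p x) v := fun p x v =>
    (hcomp (fun _ => p) (fun t => x + t • v) 0 v p x rfl (by simp) (hasDerivAt_const _ _)
      (hline x v)).unique (hHx p x v)
  have key1 : ∀ p x, Hp (gψ x - p) x = -Hp p x := by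
    intro p x
    apply dotv_sub_left'
    intro v
    have h1 := hcomp (fun t => gψ x - (p + t • v)) (fun _ => x) (-v) 0 (gψ x - p) x (by simp) rfl
      ((hline p v).const_sub _) (hasDerivAt_const _ _)
    have h2 := hHp p x v
    simp only [← hsym] at h1
    have h3 := h1.unique h2
    rw [hFp] at h3
    simp only [dotv, Pi.neg_apply, mul_neg, neg_mul, Finset.sum_neg_distrib] at h3 ⊢
    linarith
  intro t ht
  have ht' : T - t ∈ Set.Icc (0:ℝ) T := ⟨by linarith [ht.2], by linarith [ht.1]⟩
  have hr : HasDerivWithinAt (fun τ : ℝ => T - τ) (-1) (Set.Icc (0:ℝ) T) t :=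
    ((hasDerivAt_id t).const_sub T).hasDerivWithinAt
  have hm : Set.MapsTo (fun τ : ℝ => T - τ) (Set.Icc (0:ℝ) T) (Set.Icc (0:ℝ) T) :=
    fun s hs => ⟨by linarith [hs.2], by linarith [hs.1]⟩
  have hx := (hxode _ ht').scomp t hr hm
  have hp := (hpode _ ht').scomp t hr hm
  obtain ⟨A, hA, hAs⟩ := grad_deriv ψ gψ hψ hgψ (x (T - t))
  have hx' : HasDerivWithinAt (fun τ => x (T - τ))
      (Hp (gψ (x (T - t)) - p (T - t)) (x (T - t))) (Set.Icc (0:ℝ) T) t := by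
    rw [key1]
    simpa [Function.comp_def] using hx
  refine ⟨hx', ?_⟩
  have hg := HasFDerivAt.comp_hasDerivWithinAt t (f := fun τ => x (T - τ)) hA hx'
  have hfin := hg.sub hp
  refine HasDerivWithinAt.congr_deriv (f := fun τ => gψ (x (T - τ)) - p (T - τ)) hfin ?_
  generalize x (T - t) = X at *
  generalize p (T - t) = P at *
  rw [smul_neg, neg_smul, one_smul, neg_neg]
  suffices h : Hx P X = A (Hp (gψ X - P) X) + Hx (gψ X - P) X by rw [h]; abel
  apply dotv_sub_left'
  intro v
  have hA0 : HasFDerivAt gψ A (X + (0:ℝ) • v) := by simpa using hA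
  have h1 := hcomp (fun t => gψ (X + t • v) - P) (fun t => X + t • v) (A v) v (gψ X - P) X
    (by simp) (by simp) ((hA0.comp_hasDerivAt (0:ℝ) (hline X v)).sub_const P) (hline X v)
  simp only [← hsym] at h1
  have h3 := (hHx P X v).unique h1
  have h4 : ((A v, v) : (Fin N → ℝ) × (Fin N → ℝ)) = (A v, 0) + (0, v) := by simp
  rw [h4, map_add, hFp, hFx] at h3
  have h5 : dotv (Hp (gψ X - P) X) (A v) = dotv (A (Hp (gψ X - P) X)) v := by
    rw [hAs]
    simp [dotv, mul_comm]
  rw [h3, h5]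
  simp [dotv, add_mul, Finset.sum_add_distrib]
end

section
/- Let H : ℝ^N × ℝ^N → ℝ be continuously differentiable with p ↦ H(p,x) convex for each x, let ψ : ℝ^N → ℝ be twice continuously differentiable with the symmetry H(p,x) = H(∇ψ(x) − p, x) for all p, x, and define L(s,x) := sup_{p ∈ ℝ^N} (p·s − H(p,x)). Let (x(t), p(t)), t ∈ [0,T], be a C¹ solution of ẋ = ∇_p H(p,x), ṗ = −∇_x H(p,x), and set x^R(t) := x(T − t), p^{mR}(t) := ∇ψ(x^R(t)) − p(T − t). Then: (a) for every t ∈ [0,T], L(ẋ(t), x(t)) = p(t)·ẋ(t) − H(p(t), x(t)) and L(d/dt x^R(t), x^R(t)) = p^{mR}(t)·(d/dt x^R(t)) − H(p^{mR}(t), x^R(t)); (b) the actions satisfy ∫₀^T L(d/dt x^R(t), x^R(t)) dt = ∫₀^T L(ẋ(t), x(t)) dt + ψ(x(0)) − ψ(x(T)), i.e. the action cost of the time-reversed least action curve exceeds that of the forward curve by the difference of ψ at the endpoints. -/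
open scoped BigOperators

/-- The Lagrangian `L(s,x) = sup_p (p·s − H(p,x))` as a real supremum (attained along
Hamiltonian trajectories by the Fenchel equality). -/
noncomputable def LegOf {N : ℕ} (H : (Fin N → ℝ) → (Fin N → ℝ) → ℝ)
    (s x : Fin N → ℝ) : ℝ :=
  sSup {r : ℝ | ∃ p : Fin N → ℝ, r = dotv p s - H p x}

theorem leg_aux {N : ℕ} (H : (Fin N → ℝ) → (Fin N → ℝ) → ℝ) (x p g : Fin N → ℝ)
    (hconv : ConvexOn ℝ Set.univ (fun p => H p x))
    (hd : ∀ v : Fin N → ℝ, HasDerivAt (fun t : ℝ => H (p + t • v) x) (dotv g v) 0) :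
    LegOf H g x = dotv p g - H p x := by
  apply IsGreatest.csSup_eq
  refine ⟨⟨p, rfl⟩, ?_⟩
  rintro r ⟨q, rfl⟩
  have hc : ConvexOn ℝ Set.univ (fun t : ℝ => H (p + t • (q - p)) x) := by
    refine ⟨convex_univ, ?_⟩
    intro a _ b _ α β hα hβ hab
    have := hconv.2 (Set.mem_univ (p + a • (q - p))) (Set.mem_univ (p + b • (q - p))) hα hβ hab
    have e : p + (α • a + β • b) • (q - p)
        = α • (p + a • (q - p)) + β • (p + b • (q - p)) := by
      have : p = (α + β) • p := by rw [hab, one_smul]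
      ext i
      simp only [Pi.add_apply, Pi.smul_apply, Pi.sub_apply, smul_eq_mul]
      linear_combination (-p i) * hab
    simp only [e]
    exact this
  have h1 := hc.le_slope_of_hasDerivAt (Set.mem_univ (0:ℝ)) (Set.mem_univ (1:ℝ)) one_pos (hd (q - p))
  simp only [slope_def_field, one_smul, zero_smul, add_zero, sub_zero, div_one,
    add_sub_cancel] at h1
  have h2 : dotv g (q - p) = dotv q g - dotv p g := by
    simp only [dotv, Pi.sub_apply, ← Finset.sum_sub_distrib]
    exact Finset.sum_congr rfl fun i _ => by ring
  linarith

theorem dotv_single_aux {N : ℕ} (g : Fin N → ℝ) (i : Fin N) : dotv g (Pi.single i 1) = g i := by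
  simp [dotv, Pi.single_apply]

theorem dotCLM_aux {N : ℕ} (g v : Fin N → ℝ) : dotCLM g v = dotv g v := by
  simp [dotv, dotCLM]

theorem dotv_cont_aux {N : ℕ} {s : Set ℝ} {f g : ℝ → Fin N → ℝ} (hf : ContinuousOn f s)
    (hg : ContinuousOn g s) : ContinuousOn (fun t => dotv (f t) (g t)) s := by
  unfold dotv
  fun_prop

/-- action of the modified time-reversed curve.  With `H` of class `C¹`,
convex in `p`, symmetric w.r.t. `∇ψ` (`ψ` of class `C²` with gradient `gψ`), and
`(x(t),p(t))` a solution of the Hamiltonian system on `[0,T]` (so `ẋ(t) = Hp(p(t),x(t))`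
and `d/dt x^R(t) = −Hp(p(T−t),x(T−t))` for the reversed curve `x^R(t) = x(T−t)` with
modified momentum `p^{mR}(t) = ∇ψ(x^R(t)) − p(T−t)`):
(a) the Fenchel equality holds along both the forward and the reversed curve;
(b) the reversed action equals the forward action plus `ψ(x(0)) − ψ(x(T))`. -/
theorem stmt19 {N : ℕ}
    (H : (Fin N → ℝ) → (Fin N → ℝ) → ℝ)
    (Hp Hx : (Fin N → ℝ) → (Fin N → ℝ) → (Fin N → ℝ))
    (hC1 : ContDiff ℝ 1 (fun pq : (Fin N → ℝ) × (Fin N → ℝ) => H pq.1 pq.2))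
    (hHp : ∀ p x v : Fin N → ℝ,
      HasDerivAt (fun t : ℝ => H (p + t • v) x) (dotv (Hp p x) v) 0)
    (hHx : ∀ p x v : Fin N → ℝ,
      HasDerivAt (fun t : ℝ => H p (x + t • v)) (dotv (Hx p x) v) 0)
    (hconv : ∀ x : Fin N → ℝ, ConvexOn ℝ Set.univ (fun p => H p x))
    (ψ : (Fin N → ℝ) → ℝ) (gψ : (Fin N → ℝ) → (Fin N → ℝ))
    (hψ : ContDiff ℝ 2 ψ)
    (hgψ : ∀ x : Fin N → ℝ, HasFDerivAt ψ (dotCLM (gψ x)) x)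
    (hsym : ∀ p x : Fin N → ℝ, H p x = H (gψ x - p) x)
    (T : ℝ) (hT : 0 ≤ T) (x p : ℝ → Fin N → ℝ)
    (hxode : ∀ t ∈ Set.Icc (0:ℝ) T,
      HasDerivWithinAt x (Hp (p t) (x t)) (Set.Icc (0:ℝ) T) t)
    (hpode : ∀ t ∈ Set.Icc (0:ℝ) T,
      HasDerivWithinAt p (-(Hx (p t) (x t))) (Set.Icc (0:ℝ) T) t) :
    (∀ t ∈ Set.Icc (0:ℝ) T,
      LegOf H (Hp (p t) (x t)) (x t)
        = dotv (p t) (Hp (p t) (x t)) - H (p t) (x t) ∧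
      LegOf H (-(Hp (p (T - t)) (x (T - t)))) (x (T - t))
        = dotv (gψ (x (T - t)) - p (T - t)) (-(Hp (p (T - t)) (x (T - t))))
          - H (gψ (x (T - t)) - p (T - t)) (x (T - t))) ∧
    ((∫ t in (0:ℝ)..T, LegOf H (-(Hp (p (T - t)) (x (T - t)))) (x (T - t)))
      = (∫ t in (0:ℝ)..T, LegOf H (Hp (p t) (x t)) (x t)) + ψ (x 0) - ψ (x T)) := by
  have hrevd : ∀ p x v : Fin N → ℝ,
      HasDerivAt (fun t : ℝ => H (gψ x - p + t • v) x) (dotv (-(Hp p x)) v) 0 := by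
    intro p x v
    have h := hHp p x (-v)
    have e1 : (fun t : ℝ => H (gψ x - p + t • v) x) = fun t : ℝ => H (p + t • (-v)) x := by
      funext t
      rw [hsym (p + t • (-v))]
      congr 1
      rw [smul_neg]
      abel
    have e2 : dotv (-(Hp p x)) v = dotv (Hp p x) (-v) := by simp [dotv]
    rw [e1, e2]
    exact h
  have A1 : ∀ t, LegOf H (Hp (p t) (x t)) (x t)
        = dotv (p t) (Hp (p t) (x t)) - H (p t) (x t) := fun t =>
    leg_aux H _ _ _ (hconv _) (hHp _ _)
  have A2 : ∀ t, LegOf H (-(Hp (p t) (x t))) (x t)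
        = dotv (gψ (x t) - p t) (-(Hp (p t) (x t))) - H (gψ (x t) - p t) (x t) := fun t =>
    leg_aux H _ _ _ (hconv _) (hrevd _ _)
  refine ⟨fun t _ => ⟨A1 t, A2 (T - t)⟩, ?_⟩
  have hgc : Continuous gψ := by
    refine continuous_pi fun i => ?_
    have : (fun x => gψ x i) = fun x => fderiv ℝ ψ x (Pi.single i 1) := by
      funext x
      rw [(hgψ x).fderiv, dotCLM_aux, dotv_single_aux]
    rw [this]
    exact (hψ.continuous_fderiv (by norm_num)).clm_apply continuous_const
  have hHpc : Continuous (fun pq : (Fin N → ℝ) × (Fin N → ℝ) => Hp pq.1 pq.2) := by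
    refine continuous_pi fun i => ?_
    have : (fun pq : (Fin N → ℝ) × (Fin N → ℝ) => Hp pq.1 pq.2 i) = fun pq =>
        fderiv ℝ (fun pq : (Fin N → ℝ) × (Fin N → ℝ) => H pq.1 pq.2) pq
          ((Pi.single i 1 : Fin N → ℝ), (0 : Fin N → ℝ)) := by
      funext pq
      rw [← dotv_single_aux (Hp pq.1 pq.2) i]
      refine (hHp pq.1 pq.2 (Pi.single i 1)).unique ?_
      have h0 := ((hC1.differentiable (by norm_num)) pq).hasFDerivAt.hasLineDerivAt
        ((Pi.single i 1 : Fin N → ℝ), (0 : Fin N → ℝ))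
      simpa [HasLineDerivAt] using h0
    rw [this]
    exact (hC1.continuous_fderiv (by norm_num)).clm_apply continuous_const
  have hxc : ContinuousOn x (Set.Icc 0 T) := fun t ht => (hxode t ht).continuousWithinAt
  have hpc : ContinuousOn p (Set.Icc 0 T) := fun t ht => (hpode t ht).continuousWithinAt
  have hHpt : ContinuousOn (fun t => Hp (p t) (x t)) (Set.Icc 0 T) :=
    hHpc.comp_continuousOn (hpc.prodMk hxc)
  have hHt : ContinuousOn (fun t => H (p t) (x t)) (Set.Icc 0 T) :=
    hC1.continuous.comp_continuousOn (hpc.prodMk hxc)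
  have hgt : ContinuousOn (fun t => gψ (x t)) (Set.Icc 0 T) := hgc.comp_continuousOn hxc
  have hI1 : IntervalIntegrable (fun t => dotv (p t) (Hp (p t) (x t)) - H (p t) (x t))
      MeasureTheory.volume 0 T := by
    apply ContinuousOn.intervalIntegrable_of_Icc hT
    exact (dotv_cont_aux hpc hHpt).sub hHt
  have hI2 : IntervalIntegrable (fun t => dotv (gψ (x t)) (Hp (p t) (x t)))
      MeasureTheory.volume 0 T :=
    ContinuousOn.intervalIntegrable_of_Icc hT (dotv_cont_aux hgt hHpt)
  have hF : ∫ t in (0:ℝ)..T, dotv (gψ (x t)) (Hp (p t) (x t)) = ψ (x T) - ψ (x 0) := by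
    refine intervalIntegral.integral_eq_sub_of_hasDerivAt_of_le hT
      (f := fun t => ψ (x t)) (hψ.continuous.comp_continuousOn hxc) ?_ hI2
    intro t ht
    have h1 := (hxode t (Set.Ioo_subset_Icc_self ht)).hasDerivAt (Icc_mem_nhds ht.1 ht.2)
    have h2 := (hgψ (x t)).comp_hasDerivAt t h1
    rw [dotCLM_aux] at h2
    exact h2
  have hrev := intervalIntegral.integral_comp_sub_left (a := 0) (b := T)
    (fun t => LegOf H (-(Hp (p t) (x t))) (x t)) T
  simp only [sub_self, sub_zero] at hrev
  rw [hrev]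
  have A3 : ∀ t, LegOf H (-(Hp (p t) (x t))) (x t)
      = (dotv (p t) (Hp (p t) (x t)) - H (p t) (x t)) - dotv (gψ (x t)) (Hp (p t) (x t)) := by
    intro t
    rw [A2, ← hsym]
    have : dotv (gψ (x t) - p t) (-(Hp (p t) (x t)))
        = dotv (p t) (Hp (p t) (x t)) - dotv (gψ (x t)) (Hp (p t) (x t)) := by
      simp only [dotv, ← Finset.sum_sub_distrib]
      exact Finset.sum_congr rfl fun i _ => by simp only [Pi.sub_apply, Pi.neg_apply]; ring
    rw [this]
    ring
  simp only [A1, A3]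
  rw [intervalIntegral.integral_sub hI1 hI2, hF]
  ring
end
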